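/- For every R > 0 (and n ≥ 2), the Radon transform ℛ is a topological isomorphism of 𝒟_R(ℝⁿ) onto 𝒟_{H,R}(Ξ). -/

import Mathlib

open MeasureTheory Real Complex Finset

noncomputable section

variable {n : ℕ}

/-- The Radon transform, extended to a degree-zero homogeneous function of the normal
vector: for `x ≠ 0`, `RadonH f p x` is the integral of `f` over the hyperplane with unit
normal `x/‖x‖` at signed distance `p` from the origin, with respect to Lebesgue measure
on the hyperplane (realized as `(n-1)`-dimensional Hausdorff measure). -/
def RadonH (f : EuclideanSpace ℝ (Fin n) → ℂ)
    (q : ℝ × EuclideanSpace ℝ (Fin n)) : ℂ :=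
  ∫ x in {x : EuclideanSpace ℝ (Fin n) | ∑ i, x i * q.2 i = q.1 * ‖q.2‖},
    f x ∂(μH[((n : ℝ) - 1)])

/-- Membership in `𝒟_R(ℝⁿ)`: smooth and supported in the closed ball of radius `R`. -/
def IsTestFun (R : ℝ) (f : EuclideanSpace ℝ (Fin n) → ℂ) : Prop :=
  ContDiff ℝ (⊤ : ℕ∞) f ∧ ∀ x, R < ‖x‖ → f x = 0

/-- The standard seminorms of `𝒟_R(ℝⁿ)` (sup norms of iterated derivatives). -/
def dSemi (m : ℕ) (f : EuclideanSpace ℝ (Fin n) → ℂ) : ℝ :=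
  ⨆ x : EuclideanSpace ℝ (Fin n), ‖iteratedFDeriv ℝ m f x‖

/-- Functions on `ℝ × S^{n-1}`, identified with degree-zero homogeneous (in the second
variable) functions on `ℝ × (ℝⁿ ∖ {0})`. -/
def IsHomog0 (φ : ℝ × EuclideanSpace ℝ (Fin n) → ℂ) : Prop :=
  ∀ (r t : ℝ) (x : EuclideanSpace ℝ (Fin n)), 0 < t → φ (r, t • x) = φ (r, x)

/-- The seminorms `|·|_{m,D}` of `𝒟_{H,R}(Ξ)`: the sup over `[-R,R] × S^{n-1}` of the
full iterated derivative of order `m` (on `ℝ × (ℝⁿ∖{0})`), which encodes all products of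
`∂_r`-derivatives and differential operators on the sphere. -/
def bSemi (R : ℝ) (m : ℕ) (φ : ℝ × EuclideanSpace ℝ (Fin n) → ℂ) : ℝ :=
  ⨆ (r : ℝ), ⨆ (_ : |r| ≤ R), ⨆ (ω : EuclideanSpace ℝ (Fin n)), ⨆ (_ : ‖ω‖ = 1),
    ‖iteratedFDerivWithin ℝ m φ
      (Set.univ ×ˢ {x : EuclideanSpace ℝ (Fin n) | x ≠ 0}) (r, ω)‖

/-- Membership in `𝒟_{H,R}(Ξ)`: even, smooth, vanishing for `|r| > R`, and the `k`-th
moment in `r` is (the restriction to the sphere of) a homogeneous polynomial of degree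
`k` in `ω`. -/
def IsDHR (R : ℝ) (φ : ℝ × EuclideanSpace ℝ (Fin n) → ℂ) : Prop :=
  IsHomog0 φ ∧
  (∀ (r : ℝ) (x : EuclideanSpace ℝ (Fin n)), φ (-r, -x) = φ (r, x)) ∧
  ContDiffOn ℝ (⊤ : ℕ∞) φ (Set.univ ×ˢ {x : EuclideanSpace ℝ (Fin n) | x ≠ 0}) ∧
  (∀ (r : ℝ) (x : EuclideanSpace ℝ (Fin n)), R < |r| → φ (r, x) = 0) ∧
  (∀ k : ℕ, ∃ P : MvPolynomial (Fin n) ℂ, P.IsHomogeneous k ∧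
    ∀ ω : EuclideanSpace ℝ (Fin n), ‖ω‖ = 1 →
      (∫ r : ℝ, φ (r, ω) * (r : ℂ) ^ k) = MvPolynomial.eval (fun i => (ω i : ℂ)) P)

section ParametricIntegral

variable {P W F : Type} [NormedAddCommGroup P] [NormedSpace ℝ P]
  [NormedAddCommGroup W] [NormedSpace ℝ W] [NormedAddCommGroup F] [NormedSpace ℝ F]

/-- The partial derivative in the first variable of a function on a product. -/
def fderivFst (H : P × W → F) (z : P × W) : P →L[ℝ] F :=
  (fderiv ℝ H z).comp (ContinuousLinearMap.inl ℝ P W)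

lemma contDiffOn_fderivFst {S : Set P} (hS : IsOpen S) {H : P × W → F}
    (hH : ContDiffOn ℝ (⊤ : ℕ∞) H (S ×ˢ Set.univ)) :
    ContDiffOn ℝ (⊤ : ℕ∞) (fderivFst H) (S ×ˢ Set.univ) := by
  have h := hH.fderiv_of_isOpen (hS.prod isOpen_univ) (m := (⊤ : ℕ∞)) (by simp)
  exact h.clm_comp contDiffOn_const

lemma fderivFst_eq_zero {S : Set P} (hS : IsOpen S) {R : ℝ} {H : P × W → F}
    (h0 : ∀ q ∈ S, ∀ y, R < ‖y‖ → H (q, y) = 0) (q : P) (hq : q ∈ S) (y : W) (hy : R < ‖y‖) :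
    fderivFst H (q, y) = 0 := by
  have hU : IsOpen (S ×ˢ {y : W | R < ‖y‖}) :=
    hS.prod (isOpen_lt continuous_const continuous_norm)
  have : H =ᶠ[nhds (q, y)] fun _ => 0 := by
    filter_upwards [hU.mem_nhds (⟨hq, hy⟩ : (q, y) ∈ S ×ˢ {y : W | R < ‖y‖})] with z hz
    exact h0 z.1 hz.1 z.2 hz.2
  simp [fderivFst, this.fderiv_eq]

lemma norm_iteratedFDeriv_fderivFst_le {S : Set P} (hS : IsOpen S) {H : P × W → F}
    (hH : ContDiffOn ℝ (⊤ : ℕ∞) H (S ×ˢ Set.univ)) (m : ℕ) (z : P × W) (hz : z.1 ∈ S) :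
    ‖iteratedFDeriv ℝ m (fderivFst H) z‖ ≤ ‖iteratedFDeriv ℝ (m + 1) H z‖ := by
  rw [← norm_iteratedFDeriv_fderiv]
  have hO : IsOpen (S ×ˢ (Set.univ : Set W)) := hS.prod isOpen_univ
  have h := hH.fderiv_of_isOpen hO (m := (⊤ : ℕ∞)) (by simp)
  have h1 : ContDiffAt ℝ (⊤ : ℕ∞) (fderiv ℝ H) z :=
    h.contDiffAt (hO.mem_nhds ⟨hz, trivial⟩)
  let L : ((P × W) →L[ℝ] F) →L[ℝ] (P →L[ℝ] F) :=
    (ContinuousLinearMap.compL ℝ P (P × W) F).flip (ContinuousLinearMap.inl ℝ P W)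
  have hL : ‖L‖ ≤ 1 := by
    refine ContinuousLinearMap.opNorm_le_bound _ zero_le_one fun A => ?_
    have : ‖A.comp (ContinuousLinearMap.inl ℝ P W)‖ ≤ ‖A‖ * 1 :=
      (ContinuousLinearMap.opNorm_comp_le _ _).trans
        (mul_le_mul_of_nonneg_left (ContinuousLinearMap.norm_inl_le_one ℝ P W) (norm_nonneg _))
    simpa [L] using this
  have h2 : fderivFst H = L ∘ fderiv ℝ H := by ext; simp [L, fderivFst]
  rw [h2]
  refine (L.norm_iteratedFDeriv_comp_left h1 (mod_cast le_top)).trans ?_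
  exact mul_le_of_le_one_left (norm_nonneg _) hL

variable [FiniteDimensional ℝ W] [MeasurableSpace W] [BorelSpace W] {μ : Measure W}
  [IsFiniteMeasureOnCompacts μ]

omit [NormedSpace ℝ F] in
lemma integrable_of_continuous_of_norm {R : ℝ} {g : W → F} (hg : Continuous g)
    (h0 : ∀ y, R < ‖y‖ → g y = 0) : Integrable g μ := by
  refine hg.integrable_of_hasCompactSupport ?_
  refine HasCompactSupport.intro (isCompact_closedBall (0 : W) R) fun y hy => h0 y ?_
  simpa using hy

variable [FiniteDimensional ℝ P]

lemma hasFDerivAt_integral_of_contDiffOn {S : Set P} (hS : IsOpen S) {R : ℝ} {H : P × W → F}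
    (hH : ContDiffOn ℝ (⊤ : ℕ∞) H (S ×ˢ Set.univ))
    (h0 : ∀ q ∈ S, ∀ y, R < ‖y‖ → H (q, y) = 0) (q : P) (hq : q ∈ S) :
    HasFDerivAt (fun q => ∫ y, H (q, y) ∂μ) (∫ y, fderivFst H (q, y) ∂μ) q := by
  have hc (q : P) (hq : q ∈ S) : Continuous fun y => H (q, y) :=
    hH.continuousOn.comp_continuous (by fun_prop) fun y => ⟨hq, trivial⟩
  have hc' := (contDiffOn_fderivFst hS hH).continuousOn
  obtain ⟨ε, hε, hεS⟩ := Metric.isOpen_iff.1 hS q hq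
  have hsub : Metric.closedBall q (ε / 2) ⊆ S :=
    (Metric.closedBall_subset_ball (by linarith)).trans hεS
  have hK : IsCompact (Metric.closedBall q (ε / 2) ×ˢ Metric.closedBall (0 : W) R) :=
    have := FiniteDimensional.proper_real P
    have := FiniteDimensional.proper_real W
    (isCompact_closedBall _ _).prod (isCompact_closedBall _ _)
  obtain ⟨B, hB⟩ := hK.exists_bound_of_continuousOn
    (hc'.mono (Set.prod_mono hsub (Set.subset_univ _)))
  refine hasFDerivAt_integral_of_dominated_of_fderiv_le (𝕜 := ℝ)
    (F' := fun q y => fderivFst H (q, y)) (s := Metric.closedBall q (ε / 2))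
    (bound := (Metric.closedBall (0 : W) R).indicator fun _ => B)
    (Metric.closedBall_mem_nhds _ (by linarith)) ?_ ?_ ?_ ?_ ?_ ?_
  · filter_upwards [hS.mem_nhds hq] with x hx
    exact (integrable_of_continuous_of_norm (hc x hx) (h0 x hx)).aestronglyMeasurable
  · exact integrable_of_continuous_of_norm (hc q hq) (h0 q hq)
  · refine (integrable_of_continuous_of_norm (R := R) ?_ ?_).aestronglyMeasurable
    · exact hc'.comp_continuous (by fun_prop) fun y => ⟨hq, trivial⟩
    · exact fderivFst_eq_zero hS h0 q hq
  · refine .of_forall fun y x hx => ?_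
    by_cases hy : y ∈ Metric.closedBall (0 : W) R
    · simpa [hy] using hB (x, y) ⟨hx, hy⟩
    · have : R < ‖y‖ := by simpa using hy
      simp [fderivFst_eq_zero hS h0 x (hsub hx) y this, Set.indicator_of_notMem hy]
  · refine (integrable_indicator_iff Metric.isClosed_closedBall.measurableSet).2 ?_
    refine integrableOn_const ?_
    have := FiniteDimensional.proper_real W
    exact (isCompact_closedBall _ _).measure_lt_top.ne
  · refine .of_forall fun y x hx => ?_
    have h1 : DifferentiableAt ℝ H (x, y) :=
      (hH.contDiffAt ((hS.prod isOpen_univ).mem_nhds ⟨hsub hx, trivial⟩)).differentiableAt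
        (by simp)
    exact h1.hasFDerivAt.comp x (hasFDerivAt_prodMk_left x y)

/-- Integrating out the second variable of a smooth function whose support is bounded in that
variable gives a smooth function, with the expected bounds on iterated derivatives. -/
lemma contDiffOn_integral_and_bound (m : ℕ) {S : Set P} (hS : IsOpen S) {R : ℝ} :
    ∀ {F : Type} [NormedAddCommGroup F] [NormedSpace ℝ F] {H : P × W → F}
    (_ : ContDiffOn ℝ (⊤ : ℕ∞) H (S ×ˢ Set.univ))
    (_ : ∀ q ∈ S, ∀ y, R < ‖y‖ → H (q, y) = 0),
    ContDiffOn ℝ m (fun q => ∫ y, H (q, y) ∂μ) S ∧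
    ∀ q ∈ S, ∀ B : ℝ, (∀ y, ‖y‖ ≤ R → ‖iteratedFDeriv ℝ m H (q, y)‖ ≤ B) →
      ‖iteratedFDeriv ℝ m (fun q => ∫ y, H (q, y) ∂μ) q‖
        ≤ B * μ.real (Metric.closedBall 0 R) := by
  have := FiniteDimensional.proper_real W
  induction m with
  | zero =>
    intro F _ _ H hH h0
    refine ⟨?_, fun q hq B hB => ?_⟩
    · have : ContinuousOn (fun q => ∫ y, H (q, y) ∂μ) S := fun q hq =>
        (hasFDerivAt_integral_of_contDiffOn hS hH h0 q hq).continuousAt.continuousWithinAt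
      simpa using this
    · have h1 : (∫ y, H (q, y) ∂μ) = ∫ y in Metric.closedBall 0 R, H (q, y) ∂μ := by
        refine (setIntegral_eq_integral_of_forall_compl_eq_zero fun y hy => h0 q hq y ?_).symm
        simpa using hy
      rw [norm_iteratedFDeriv_zero, h1]
      refine norm_setIntegral_le_of_norm_le_const (isCompact_closedBall _ _).measure_lt_top ?_
      intro y hy
      simpa using hB y (by simpa using hy)
  | succ m ih =>
    intro F _ _ H hH h0
    have hder := hasFDerivAt_integral_of_contDiffOn (μ := μ) hS hH h0
    obtain ⟨ih1, ih2⟩ := ih (contDiffOn_fderivFst hS hH) (fderivFst_eq_zero hS h0)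
    refine ⟨?_, fun q hq B hB => ?_⟩
    · rw [Nat.cast_add, Nat.cast_one, contDiffOn_succ_iff_fderiv_of_isOpen hS]
      refine ⟨fun q hq => (hder q hq).differentiableAt.differentiableWithinAt, by simp, ?_⟩
      exact ih1.congr fun q hq => (hder q hq).fderiv
    · have h1 : fderiv ℝ (fun q => ∫ y, H (q, y) ∂μ) =ᶠ[nhds q]
          fun q => ∫ y, fderivFst H (q, y) ∂μ := by
        filter_upwards [hS.mem_nhds hq] with x hx using (hder x hx).fderiv
      rw [← norm_iteratedFDeriv_fderiv, (h1.iteratedFDeriv ℝ m).eq_of_nhds]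
      exact ih2 q hq B fun y hy =>
        (norm_iteratedFDeriv_fderivFst_le hS hH m (q, y) hq).trans (hB y hy)

end ParametricIntegral

section Frames

/-- Euclidean space of dimension `k`. -/
abbrev Euc (k : ℕ) := EuclideanSpace ℝ (Fin k)

/-- A unit vector of `ℝ^{d+1}` together with an isometric parametrization of its orthogonal
complement. -/
structure HypFrame (d : ℕ) where
  /-- the unit normal -/
  nor : Euc (d + 1)
  norm_nor : ‖nor‖ = 1
  /-- the parametrization of the orthogonal complement -/
  emb : Euc d →ₗᵢ[ℝ] Euc (d + 1)
  range_emb : ∀ v, (∃ y, emb y = v) ↔ inner ℝ v nor = 0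

namespace HypFrame

variable {d : ℕ}

lemma exists_nor_eq (ω : Euc (d + 1)) (hω : ‖ω‖ = 1) : ∃ F : HypFrame d, F.nor = ω := by
  have hω0 : ω ≠ 0 := by
    rintro rfl
    simp at hω
  have : Fact (Module.finrank ℝ (Euc (d + 1)) = d + 1) := ⟨by simp⟩
  have hfr : Module.finrank ℝ (ℝ ∙ ω)ᗮ = d := Submodule.finrank_orthogonal_span_singleton hω0
  let e : Euc d ≃ₗᵢ[ℝ] (ℝ ∙ ω)ᗮ :=
    ((stdOrthonormalBasis ℝ (ℝ ∙ ω)ᗮ).reindex (finCongr hfr)).repr.symm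
  refine ⟨⟨ω, hω, (ℝ ∙ ω)ᗮ.subtypeₗᵢ.comp e.toLinearIsometry, fun v => ?_⟩, rfl⟩
  rw [real_inner_comm, ← Submodule.mem_orthogonal_singleton_iff_inner_right]
  constructor
  · rintro ⟨y, rfl⟩
    simp
  · intro hv
    exact ⟨e.symm ⟨v, hv⟩, by simp⟩

variable (F : HypFrame d)

@[simp] lemma inner_emb_nor (y : Euc d) : inner ℝ (F.emb y) F.nor = 0 :=
  (F.range_emb _).1 ⟨y, rfl⟩

@[simp] lemma inner_nor_nor : inner ℝ F.nor F.nor = 1 := by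
  rw [real_inner_self_eq_norm_sq, F.norm_nor, one_pow]

/-- The point of the hyperplane at signed distance `p` with parameter `y`. -/
def pt (y : Euc d) (p : ℝ) : Euc (d + 1) := F.emb y + p • F.nor

@[simp] lemma inner_pt_nor (y : Euc d) (p : ℝ) : inner ℝ (F.pt y p) F.nor = p := by
  simp [pt, inner_add_left, inner_smul_left, F.norm_nor]

lemma norm_pt_sq (y : Euc d) (p : ℝ) : ‖F.pt y p‖ ^ 2 = ‖y‖ ^ 2 + p ^ 2 := by
  rw [pt, norm_add_sq_real, inner_smul_right, inner_emb_nor, F.emb.norm_map, norm_smul,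
    F.norm_nor]
  simp

lemma norm_le_norm_pt (y : Euc d) (p : ℝ) : ‖y‖ ≤ ‖F.pt y p‖ := by
  refine le_of_sq_le_sq ?_ (norm_nonneg _)
  rw [norm_pt_sq]
  nlinarith [sq_nonneg p]

lemma abs_le_norm_pt (y : Euc d) (p : ℝ) : |p| ≤ ‖F.pt y p‖ := by
  refine le_of_sq_le_sq ?_ (norm_nonneg _)
  rw [norm_pt_sq, sq_abs]
  nlinarith [sq_nonneg ‖y‖]

lemma exists_pt_eq_iff (p : ℝ) (v : Euc (d + 1)) :
    (∃ y, F.pt y p = v) ↔ inner ℝ v F.nor = p := by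
  have h : (∃ y, F.pt y p = v) ↔ ∃ y, F.emb y = v - p • F.nor := by
    simp [pt, eq_sub_iff_add_eq]
  rw [h, F.range_emb, inner_sub_left, inner_smul_left]
  simp [sub_eq_zero, F.norm_nor]

/-- The decomposition of space induced by a frame, as a continuous linear equivalence. -/
def equiv : (Euc d × ℝ) ≃L[ℝ] Euc (d + 1) :=
  LinearEquiv.toContinuousLinearEquiv <| LinearEquiv.ofBijective
    (F.emb.toLinearMap.coprod (LinearMap.toSpanSingleton ℝ _ F.nor))
    (by
      constructor
      · rw [← LinearMap.ker_eq_bot, LinearMap.ker_eq_bot']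
        rintro ⟨y, p⟩ h
        have h1 : ‖F.pt y p‖ ^ 2 = 0 := by
          have : F.pt y p = 0 := by simpa [pt] using h
          simp [this]
        rw [norm_pt_sq] at h1
        have hy : ‖y‖ ^ 2 = 0 := by nlinarith [sq_nonneg ‖y‖, sq_nonneg p]
        have hp : p ^ 2 = 0 := by nlinarith [sq_nonneg ‖y‖, sq_nonneg p]
        simpa using And.intro hy hp
      · intro v
        obtain ⟨y, hy⟩ := (F.exists_pt_eq_iff (inner ℝ v F.nor) v).2 rfl
        exact ⟨(y, inner ℝ v F.nor), by simpa [pt] using hy⟩)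

lemma equiv_apply (z : Euc d × ℝ) : F.equiv z = F.pt z.1 z.2 := by
  rfl

/-- The image of a frame under an isometry. -/
def map (T : Euc (d + 1) ≃ₗᵢ[ℝ] Euc (d + 1)) : HypFrame d where
  nor := T F.nor
  norm_nor := by rw [T.norm_map, F.norm_nor]
  emb := T.toLinearIsometry.comp F.emb
  range_emb v := by
    have h : inner ℝ v (T F.nor) = inner ℝ (T.symm v) F.nor := by
      rw [← T.inner_map_map (T.symm v), T.apply_symm_apply]
    rw [h, ← F.range_emb]
    simp [LinearIsometryEquiv.eq_symm_apply]

lemma map_pt (T : Euc (d + 1) ≃ₗᵢ[ℝ] Euc (d + 1)) (y : Euc d) (p : ℝ) :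
    (F.map T).pt y p = T (F.pt y p) := by
  simp [map, pt]

lemma exists_map_nor_eq (ω : Euc (d + 1)) (hω : ‖ω‖ = 1) :
    ∃ T : Euc (d + 1) ≃ₗᵢ[ℝ] Euc (d + 1), T F.nor = ω :=
  ⟨_, Submodule.reflection_sub (F.norm_nor.trans hω.symm)⟩

end HypFrame

instance (d : ℕ) : Measure.IsAddHaarMeasure (μH[(d : ℝ)] : Measure (Euc d)) := by
  simpa using isAddHaarMeasure_hausdorffMeasure (E := Euc d)

variable {d : ℕ}

/-- The Radon transform as an integral over the parameters of a frame. -/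
lemma radonH_eq_integral (F : HypFrame d) (f : Euc (d + 1) → ℂ) (p t : ℝ) (ht : 0 < t) :
    RadonH f (p, t • F.nor) = ∫ y, f (F.pt y p) ∂(μH[(d : ℝ)] : Measure (Euc d)) := by
  have hiso : Isometry fun y => F.pt y p := by
    refine Isometry.of_dist_eq fun x y => ?_
    simp [HypFrame.pt, F.emb.dist_map]
  have hset : {x : Euc (d + 1) | ∑ i, x i * (t • F.nor) i = p * ‖t • F.nor‖} =
      Set.range fun y => F.pt y p := by
    ext x
    have h1 : ∑ i, x i * (t • F.nor) i = t * inner ℝ x F.nor := by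
      simp [PiLp.inner_apply, Finset.mul_sum]
      exact Finset.sum_congr rfl fun i _ => by ring
    have h2 : ‖t • F.nor‖ = t := by rw [norm_smul, F.norm_nor]; simp [abs_of_pos ht]
    rw [Set.mem_range, F.exists_pt_eq_iff, Set.mem_ofPred_eq, h1, h2, mul_comm p]
    exact mul_right_inj' ht.ne'
  have hd : ((d + 1 : ℕ) : ℝ) - 1 = d := by simp
  rw [RadonH, hset, hd, ← hiso.map_hausdorffMeasure (Or.inl (by positivity)),
    hiso.isClosedEmbedding.measurableEmbedding.integral_map]

/-- The constant relating the product measure `μH[d] × dp` to Lebesgue measure. -/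
lemma exists_map_equiv_eq_smul (d : ℕ) : ∃ c : NNReal, 0 < c ∧ ∀ F : HypFrame d,
    Measure.map F.equiv ((μH[(d : ℝ)] : Measure (Euc d)).prod volume) = c • volume := by
  let B : Set (Euc (d + 1)) := Metric.ball 0 1
  have hB0 : volume B ≠ 0 := (Metric.measure_ball_pos _ _ one_pos).ne'
  have hBt : volume B ≠ ⊤ := measure_ball_lt_top.ne
  let ν : Measure (Euc d × ℝ) := (μH[(d : ℝ)] : Measure (Euc d)).prod volume
  have hF (F : HypFrame d) : ∃ c : NNReal, 0 < c ∧ Measure.map F.equiv ν = c • volume := by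
    have : (Measure.map F.equiv ν).IsAddHaarMeasure := F.equiv.isAddHaarMeasure_map ν
    exact ⟨_, Measure.addHaarScalarFactor_pos_of_isAddHaarMeasure _ _,
      Measure.isAddLeftInvariant_eq_smul _ _⟩
  have hpre (F : HypFrame d) : Measure.map F.equiv ν B = ν {z | ‖z.1‖ ^ 2 + z.2 ^ 2 < 1} := by
    rw [Measure.map_apply F.equiv.continuous.measurable Metric.isOpen_ball.measurableSet]
    congr 1
    ext z
    simp only [Set.mem_preimage, mem_ball_zero_iff, Set.mem_ofPred_eq, F.equiv_apply,
      ← F.norm_pt_sq]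
    rw [sq_lt_one_iff₀ (norm_nonneg _)]
  obtain ⟨F₀, -⟩ := HypFrame.exists_nor_eq (d := d) (EuclideanSpace.single 0 1) (by simp)
  obtain ⟨c₀, hc₀, h₀⟩ := hF F₀
  refine ⟨c₀, hc₀, fun F => ?_⟩
  obtain ⟨c, hc, h⟩ := hF F
  suffices c = c₀ by rw [← this]; exact h
  have h1 : c * volume B = c₀ * volume B := by
    have := (hpre F).trans (hpre F₀).symm
    rw [h, h₀] at this
    exact this
  exact_mod_cast (ENNReal.mul_left_inj hB0 hBt).1 h1

end Frames

section Bounds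

section TestFunctions

variable {R : ℝ} {f : Euc n → ℂ}

lemma IsTestFun.hasCompactSupport (hf : IsTestFun R f) : HasCompactSupport f :=
  HasCompactSupport.intro (isCompact_closedBall 0 R) fun x hx => hf.2 x (by simpa using hx)

lemma IsTestFun.comp_isometry (hf : IsTestFun R f) (T : Euc n ≃ₗᵢ[ℝ] Euc n) :
    IsTestFun R (f ∘ T) :=
  ⟨hf.1.comp T.contDiff, fun x hx => hf.2 _ (by rwa [T.norm_map])⟩

lemma IsTestFun.norm_iteratedFDeriv_le_dSemi (hf : IsTestFun R f) (m : ℕ) (x : Euc n) :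
    ‖iteratedFDeriv ℝ m f x‖ ≤ dSemi m f := by
  have hc : Continuous (iteratedFDeriv ℝ m f) :=
    hf.1.continuous_iteratedFDeriv (mod_cast le_top)
  obtain ⟨C, hC⟩ := hc.bounded_above_of_compact_support (hf.hasCompactSupport.iteratedFDeriv m)
  exact le_ciSup (f := fun x => ‖iteratedFDeriv ℝ m f x‖) ⟨C, by rintro _ ⟨y, rfl⟩; exact hC y⟩ x

lemma dSemi_nonneg (m : ℕ) (f : Euc n → ℂ) : 0 ≤ dSemi m f :=
  Real.iSup_nonneg fun _ => norm_nonneg _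

/-- The Schwartz function underlying a test function. -/
def IsTestFun.toSchwartz (hf : IsTestFun R f) : SchwartzMap (Euc n) ℂ :=
  hf.hasCompactSupport.toSchwartzMap hf.1

lemma IsTestFun.toSchwartz_apply (hf : IsTestFun R f) (x : Euc n) : hf.toSchwartz x = f x := by
  simp [toSchwartz]

lemma IsTestFun.coe_toSchwartz (hf : IsTestFun R f) : ⇑hf.toSchwartz = f :=
  funext hf.toSchwartz_apply

end TestFunctions

variable {d : ℕ}

/-- Every nonzero vector is a positive multiple of the normal of some frame. -/
lemma exists_frame_smul (x : Euc (d + 1)) (hx : x ≠ 0) :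
    ∃ F : HypFrame d, x = ‖x‖ • F.nor := by
  have hx' : ‖x‖ ≠ 0 := norm_ne_zero_iff.2 hx
  obtain ⟨F, hF⟩ := HypFrame.exists_nor_eq (‖x‖⁻¹ • x) (by simp [norm_smul, hx'])
  exact ⟨F, by rw [hF, smul_smul, mul_inv_cancel₀ hx', one_smul]⟩

lemma radonH_comp_isometry (f : Euc (d + 1) → ℂ) (T : Euc (d + 1) ≃ₗᵢ[ℝ] Euc (d + 1)) (p : ℝ)
    (x : Euc (d + 1)) (hx : x ≠ 0) : RadonH f (p, T x) = RadonH (f ∘ T) (p, x) := by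
  obtain ⟨F, hF⟩ := exists_frame_smul x hx
  have hx' : 0 < ‖x‖ := norm_pos_iff.2 hx
  have h : T x = ‖x‖ • (F.map T).nor := by
    conv_lhs => rw [hF]
    rw [map_smul]
    rfl
  conv_rhs => rw [hF]
  rw [h, radonH_eq_integral _ _ _ _ hx', radonH_eq_integral _ _ _ _ hx']
  simp_rw [F.map_pt]
  rfl

namespace HypFrame

variable (F : HypFrame d)

/-- The open half-space of normals on which `HypFrame.chart` is defined. -/
def chartDom : Set (ℝ × Euc (d + 1)) := {q | 0 < inner ℝ q.2 F.nor}

lemma isOpen_chartDom : IsOpen F.chartDom :=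
  isOpen_lt continuous_const (by fun_prop)

lemma chartDom_subset : F.chartDom ⊆ Set.univ ×ˢ {x : Euc (d + 1) | x ≠ 0} := by
  intro q hq
  refine ⟨trivial, fun h => ?_⟩
  rw [chartDom, Set.mem_ofPred_eq, h] at hq
  simp at hq

lemma mem_chartDom (p t : ℝ) (ht : 0 < t) : (p, t • F.nor) ∈ F.chartDom := by
  simp [chartDom, inner_smul_left, F.norm_nor, ht]

/-- A parametrization of the hyperplanes with normal close to that of the frame: the parametrized
hyperplane of the frame is reflected through the bisector of the two normals. -/
def chart (z : (ℝ × Euc (d + 1)) × Euc d) : Euc (d + 1) :=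
  2 • (inner ℝ (z.1.2 + ‖z.1.2‖ • F.nor) (F.pt z.2 z.1.1) / ‖z.1.2 + ‖z.1.2‖ • F.nor‖ ^ 2) •
    (z.1.2 + ‖z.1.2‖ • F.nor) - F.pt z.2 z.1.1

lemma chart_eq_reflection (q : ℝ × Euc (d + 1)) (y : Euc d) :
    F.chart (q, y) = Submodule.reflection (ℝ ∙ (q.2 + ‖q.2‖ • F.nor)) (F.pt y q.1) := by
  rw [Submodule.reflection_singleton_apply]
  rfl

lemma norm_chart (q : ℝ × Euc (d + 1)) (y : Euc d) : ‖F.chart (q, y)‖ = ‖F.pt y q.1‖ := by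
  rw [chart_eq_reflection, LinearIsometryEquiv.norm_map]

lemma bisector_ne_zero {q : ℝ × Euc (d + 1)} (hq : q ∈ F.chartDom) :
    q.2 + ‖q.2‖ • F.nor ≠ 0 := by
  intro h
  have h1 : inner ℝ (q.2 + ‖q.2‖ • F.nor) F.nor = 0 := by rw [h, inner_zero_left]
  rw [inner_add_left, inner_smul_left, F.inner_nor_nor] at h1
  have h2 : 0 < inner ℝ q.2 F.nor := hq
  have h3 := norm_nonneg q.2
  simp at h1
  linarith

lemma contDiffOn_chart : ContDiffOn ℝ (⊤ : ℕ∞) F.chart (F.chartDom ×ˢ Set.univ) := by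
  intro z hz
  have hz0 : z.1.2 ≠ 0 := (F.chartDom_subset hz.1).2
  have hu := F.bisector_ne_zero hz.1
  have h1 : ContDiffAt ℝ (⊤ : ℕ∞) (fun z : (ℝ × Euc (d + 1)) × Euc d =>
      z.1.2 + ‖z.1.2‖ • F.nor) z := by
    have h2 : ContDiffAt ℝ (⊤ : ℕ∞) (fun z : (ℝ × Euc (d + 1)) × Euc d => z.1.2) z := by fun_prop
    exact h2.add ((h2.norm ℝ hz0).smul contDiffAt_const)
  have h3 : ContDiffAt ℝ (⊤ : ℕ∞) (fun z : (ℝ × Euc (d + 1)) × Euc d =>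
      F.pt z.2 z.1.1) z := by
    have := F.emb.contDiff (n := (⊤ : ℕ∞))
    unfold pt
    fun_prop
  refine ContDiffAt.contDiffWithinAt ?_
  have h4 := (h1.inner ℝ h3).div (h1.norm_sq ℝ) (by simpa using hu)
  exact ((h4.smul h1).const_smul 2).sub h3

lemma radonH_eq_integral_chart (f : Euc (d + 1) → ℂ) {q : ℝ × Euc (d + 1)}
    (hq : q ∈ F.chartDom) :
    RadonH f q = ∫ y, f (F.chart (q, y)) ∂(μH[(d : ℝ)] : Measure (Euc d)) := by
  obtain ⟨p, x⟩ := q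
  have hx0 : x ≠ 0 := (F.chartDom_subset hq).2
  have hx : 0 < ‖x‖ := norm_pos_iff.2 hx0
  have hu0 := F.bisector_ne_zero hq
  set u := x + ‖x‖ • F.nor with hu
  let T := Submodule.reflection (ℝ ∙ u)
  have hsq : ‖u‖ ^ 2 = 2 * ‖x‖ * inner ℝ u F.nor := by
    rw [hu, norm_add_sq_real, norm_smul, F.norm_nor, inner_add_left, inner_smul_left,
      inner_smul_right, F.inner_nor_nor]
    simp
    ring
  have hT : x = ‖x‖ • (F.map T).nor := by
    have hi : inner ℝ u F.nor ≠ 0 := by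
      intro h
      rw [h, mul_zero] at hsq
      exact hu0 (by simpa using hsq)
    have h1 : (F.map T).nor = 2 • (inner ℝ u F.nor / ‖u‖ ^ 2) • u - F.nor :=
      Submodule.reflection_singleton_apply (𝕜 := ℝ) u F.nor
    have h2 : ‖x‖ * (2 * (inner ℝ u F.nor / ‖u‖ ^ 2)) = 1 := by
      rw [hsq]
      field_simp
    rw [h1, ← Nat.cast_smul_eq_nsmul ℝ, smul_smul, smul_sub, smul_smul, Nat.cast_ofNat, h2, hu]
    simp
  conv_lhs => rw [hT]
  rw [radonH_eq_integral _ _ _ _ hx]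
  refine integral_congr_ae (.of_forall fun y => ?_)
  simp only [F.chart_eq_reflection, F.map_pt]
  rfl

lemma contDiffOn_comp_chart {f : Euc (d + 1) → ℂ} (hf : ContDiff ℝ (⊤ : ℕ∞) f) :
    ContDiffOn ℝ (⊤ : ℕ∞) (fun z => f (F.chart z)) (F.chartDom ×ˢ Set.univ) :=
  hf.comp_contDiffOn F.contDiffOn_chart

lemma comp_chart_eq_zero {R : ℝ} {f : Euc (d + 1) → ℂ} (hf : IsTestFun R f)
    (q : ℝ × Euc (d + 1)) (y : Euc d) (hy : R < ‖y‖) : f (F.chart (q, y)) = 0 :=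
  hf.2 _ (hy.trans_le (by rw [norm_chart]; exact F.norm_le_norm_pt y q.1))

lemma contDiffOn_radonH {R : ℝ} {f : Euc (d + 1) → ℂ} (hf : IsTestFun R f) :
    ContDiffOn ℝ (⊤ : ℕ∞) (RadonH f) F.chartDom := by
  refine ContDiffOn.congr ?_ fun q hq => F.radonH_eq_integral_chart f hq
  rw [contDiffOn_infty]
  exact fun m => (contDiffOn_integral_and_bound m F.isOpen_chartDom (F.contDiffOn_comp_chart hf.1)
    fun q _ y hy => F.comp_chart_eq_zero hf q y hy).1

lemma exists_chart_bound (R : ℝ) (m : ℕ) : ∃ D : ℝ, ∀ i, 1 ≤ i → i ≤ m →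
    ∀ p : ℝ, |p| ≤ R → ∀ y : Euc d, ‖y‖ ≤ R →
      ‖iteratedFDerivWithin ℝ i F.chart (F.chartDom ×ˢ Set.univ) ((p, F.nor), y)‖ ≤ D ^ i := by
  have hO : IsOpen (F.chartDom ×ˢ (Set.univ : Set (Euc d))) := F.isOpen_chartDom.prod isOpen_univ
  let K : Set ((ℝ × Euc (d + 1)) × Euc d) :=
    (Metric.closedBall 0 R ×ˢ {F.nor}) ×ˢ Metric.closedBall 0 R
  have hK : IsCompact K :=
    ((isCompact_closedBall _ _).prod isCompact_singleton).prod (isCompact_closedBall _ _)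
  have hKs : K ⊆ F.chartDom ×ˢ Set.univ := by
    rintro ⟨⟨p, x⟩, y⟩ ⟨⟨-, hx⟩, -⟩
    refine ⟨?_, trivial⟩
    obtain rfl : x = F.nor := hx
    simpa using F.mem_chartDom p 1 one_pos
  have hb (i : ℕ) : ∃ b : ℝ, ∀ z ∈ K,
      ‖iteratedFDerivWithin ℝ i F.chart (F.chartDom ×ˢ Set.univ) z‖ ≤ b :=
    hK.exists_bound_of_continuousOn
      ((F.contDiffOn_chart.continuousOn_iteratedFDerivWithin (mod_cast le_top)
        hO.uniqueDiffOn).mono hKs)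
  choose b hb using hb
  have hsum : 0 ≤ ∑ j ∈ range (m + 1), |b j| := Finset.sum_nonneg fun _ _ => abs_nonneg _
  refine ⟨1 + ∑ j ∈ range (m + 1), |b j|, fun i hi him p hp y hy => ?_⟩
  calc _ ≤ b i := hb i _ ⟨⟨by simpa using hp, Set.mem_singleton _⟩, by simpa using hy⟩
    _ ≤ |b i| := le_abs_self _
    _ ≤ ∑ j ∈ range (m + 1), |b j| :=
      Finset.single_le_sum (f := fun j => |b j|) (fun _ _ => abs_nonneg _) (by simp; omega)
    _ ≤ 1 + ∑ j ∈ range (m + 1), |b j| := by linarith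
    _ ≤ _ := le_self_pow₀ (by linarith) (by omega)

lemma exists_radonH_bound (R : ℝ) (m : ℕ) : ∃ C : ℝ, 0 < C ∧
    ∀ f : Euc (d + 1) → ℂ, IsTestFun R f → ∀ p : ℝ, |p| ≤ R →
      ‖iteratedFDeriv ℝ m (RadonH f) (p, F.nor)‖ ≤ C * ∑ i ∈ range (m + 1), dSemi i f := by
  have hO : IsOpen (F.chartDom ×ˢ (Set.univ : Set (Euc d))) := F.isOpen_chartDom.prod isOpen_univ
  obtain ⟨D, hD⟩ := F.exists_chart_bound R m
  let V := (μH[(d : ℝ)] : Measure (Euc d)).real (Metric.closedBall 0 R)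
  refine ⟨|m.factorial * D ^ m * V| + 1, by positivity, fun f hf p hp => ?_⟩
  have hq : (p, F.nor) ∈ F.chartDom := by simpa using F.mem_chartDom p 1 one_pos
  have hS : 0 ≤ ∑ i ∈ range (m + 1), dSemi i f := Finset.sum_nonneg fun _ _ => dSemi_nonneg _ _
  have h1 : RadonH f =ᶠ[nhds (p, F.nor)]
      fun q => ∫ y, f (F.chart (q, y)) ∂(μH[(d : ℝ)] : Measure (Euc d)) := by
    filter_upwards [F.isOpen_chartDom.mem_nhds hq] with x hx
    exact F.radonH_eq_integral_chart f hx
  rw [(h1.iteratedFDeriv ℝ m).eq_of_nhds]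
  have h2 := (contDiffOn_integral_and_bound (μ := (μH[(d : ℝ)] : Measure (Euc d))) m
    F.isOpen_chartDom (F.contDiffOn_comp_chart hf.1)
    fun q _ y hy => F.comp_chart_eq_zero hf q y hy).2 _ hq
    (m.factorial * (∑ i ∈ range (m + 1), dSemi i f) * D ^ m) fun y hy => by
      have hmem : ((p, F.nor), y) ∈ F.chartDom ×ˢ (Set.univ : Set (Euc d)) := ⟨hq, trivial⟩
      rw [← iteratedFDerivWithin_of_isOpen m hO hmem]
      refine norm_iteratedFDerivWithin_comp_le (g := f) (t := Set.univ) hf.1.contDiffOn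
        F.contDiffOn_chart (mod_cast le_top) uniqueDiffOn_univ hO.uniqueDiffOn
        (Set.mapsTo_univ _ _) hmem (fun i hi => ?_) (fun i hi him => hD i hi him p hp y hy)
      rw [iteratedFDerivWithin_univ]
      exact (hf.norm_iteratedFDeriv_le_dSemi i _).trans
        (Finset.single_le_sum (f := fun i => dSemi i f) (fun _ _ => dSemi_nonneg _ _)
          (by simp; omega))
  refine h2.trans ?_
  calc _ = (m.factorial * D ^ m * V) * ∑ i ∈ range (m + 1), dSemi i f := by ring
    _ ≤ _ := mul_le_mul_of_nonneg_right ((le_abs_self _).trans (by linarith)) hS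

end HypFrame

lemma contDiffOn_radonH_ne_zero {R : ℝ} {f : Euc (d + 1) → ℂ} (hf : IsTestFun R f) :
    ContDiffOn ℝ (⊤ : ℕ∞) (RadonH f) (Set.univ ×ˢ {x : Euc (d + 1) | x ≠ 0}) := by
  rintro ⟨p, x⟩ ⟨-, hx⟩
  obtain ⟨F, hF⟩ := exists_frame_smul x hx
  have hq : (p, x) ∈ F.chartDom := by
    rw [hF]
    exact F.mem_chartDom p _ (norm_pos_iff.2 hx)
  exact ((F.contDiffOn_radonH hf).contDiffAt (F.isOpen_chartDom.mem_nhds hq)).contDiffWithinAt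

/-- An isometry acting on the second factor of `ℝ × ℝⁿ`. -/
def isometrySnd (T : Euc n ≃ₗᵢ[ℝ] Euc n) : (ℝ × Euc n) ≃ₗᵢ[ℝ] (ℝ × Euc n) where
  toLinearEquiv := (LinearEquiv.refl ℝ ℝ).prodCongr T.toLinearEquiv
  norm_map' x := by simp [Prod.norm_def]

lemma isOpen_ne_zero : IsOpen (Set.univ ×ˢ {x : Euc n | x ≠ 0} : Set (ℝ × Euc n)) :=
  isOpen_univ.prod isOpen_ne

lemma exists_radonH_bound_sphere (d : ℕ) (R : ℝ) (m : ℕ) : ∃ C : ℝ, 0 < C ∧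
    ∀ f : Euc (d + 1) → ℂ, IsTestFun R f → ∀ (p : ℝ) (ω : Euc (d + 1)), |p| ≤ R → ‖ω‖ = 1 →
      ‖iteratedFDerivWithin ℝ m (RadonH f) (Set.univ ×ˢ {x : Euc (d + 1) | x ≠ 0}) (p, ω)‖
        ≤ C * ∑ i ∈ range (m + 1), dSemi i f := by
  obtain ⟨F, -⟩ := HypFrame.exists_nor_eq (d := d) (EuclideanSpace.single 0 1) (by simp)
  obtain ⟨C, hC, h⟩ := F.exists_radonH_bound R m
  refine ⟨C, hC, fun f hf p ω hp hω => ?_⟩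
  obtain ⟨T, rfl⟩ := F.exists_map_nor_eq ω hω
  have hnor0 : F.nor ≠ 0 := by
    intro h0
    simpa [h0] using F.norm_nor
  have hmem (x : Euc (d + 1)) (hx : x ≠ 0) :
      (p, x) ∈ (Set.univ ×ˢ {x : Euc (d + 1) | x ≠ 0} : Set (ℝ × Euc (d + 1))) :=
    ⟨trivial, hx⟩
  rw [iteratedFDerivWithin_of_isOpen m isOpen_ne_zero (hmem _ (by simpa using hnor0))]
  have h1 : RadonH f ∘ isometrySnd T =ᶠ[nhds (p, F.nor)] RadonH (f ∘ T) := by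
    filter_upwards [isOpen_ne_zero.mem_nhds (hmem _ hnor0)] with q hq
    exact radonH_comp_isometry f T q.1 q.2 hq.2
  have h2 : (p, T F.nor) = isometrySnd T (p, F.nor) := rfl
  rw [h2, ← LinearIsometryEquiv.norm_iteratedFDeriv_comp_right, (h1.iteratedFDeriv ℝ m).eq_of_nhds]
  refine (h _ (hf.comp_isometry T) p hp).trans_eq ?_
  congr 1
  refine Finset.sum_congr rfl fun i _ => ?_
  unfold dSemi
  simp_rw [LinearIsometryEquiv.norm_iteratedFDeriv_comp_right]
  exact T.surjective.iSup_comp (g := fun x => ‖iteratedFDeriv ℝ i f x‖)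

lemma bSemi_le {R : ℝ} {m : ℕ} {φ : ℝ × Euc n → ℂ} {B : ℝ} (hB : 0 ≤ B)
    (h : ∀ (p : ℝ) (ω : Euc n), |p| ≤ R → ‖ω‖ = 1 →
      ‖iteratedFDerivWithin ℝ m φ (Set.univ ×ˢ {x : Euc n | x ≠ 0}) (p, ω)‖ ≤ B) :
    bSemi R m φ ≤ B :=
  Real.iSup_le (fun p => Real.iSup_le (fun hp => Real.iSup_le (fun ω =>
    Real.iSup_le (fun hω => h p ω hp hω) hB) hB) hB) hB

lemma exists_bSemi_radonH_le (d : ℕ) (R : ℝ) (m : ℕ) : ∃ C > (0 : ℝ), ∃ M : ℕ,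
    ∀ f : Euc (d + 1) → ℂ, IsTestFun R f →
      bSemi R m (RadonH f) ≤ C * ∑ m' ∈ Finset.range (M + 1), dSemi m' f := by
  obtain ⟨C, hC, h⟩ := exists_radonH_bound_sphere d R m
  refine ⟨C, hC, m, fun f hf => bSemi_le ?_ (h f hf)⟩
  exact mul_nonneg hC.le (Finset.sum_nonneg fun _ _ => dSemi_nonneg _ _)

end Bounds

section Slicing

variable {d : ℕ}

/-- Lebesgue measure on hyperplanes, as a measure on `Euc d`. -/
abbrev hypMeasure (d : ℕ) : Measure (Euc d) := μH[(d : ℝ)]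

/-- The constant relating the product of the hyperplane measure and the Lebesgue measure on the
normal line to the Lebesgue measure on the whole space. -/
def sliceConst (d : ℕ) : ℝ := (exists_map_equiv_eq_smul d).choose

lemma sliceConst_pos (d : ℕ) : 0 < sliceConst d :=
  NNReal.coe_pos.2 (exists_map_equiv_eq_smul d).choose_spec.1

namespace HypFrame

variable (F : HypFrame d)

lemma map_equiv_eq_smul : Measure.map F.equiv ((hypMeasure d).prod volume) =
    (exists_map_equiv_eq_smul d).choose • volume :=
  (exists_map_equiv_eq_smul d).choose_spec.2 F

lemma integrable_comp_pt {g : Euc (d + 1) → ℂ} (hg : Integrable g) :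
    Integrable (fun z : Euc d × ℝ => g (F.pt z.1 z.2)) ((hypMeasure d).prod volume) := by
  have h : Integrable g (Measure.map F.equiv ((hypMeasure d).prod volume)) := by
    rw [map_equiv_eq_smul]
    exact hg.smul_measure_nnreal
  exact (F.equiv.toHomeomorph.measurableEmbedding.integrable_map_iff).1 h

lemma integral_comp_pt (g : Euc (d + 1) → ℂ) :
    ∫ z : Euc d × ℝ, g (F.pt z.1 z.2) ∂((hypMeasure d).prod volume) =
      sliceConst d * ∫ x, g x := by
  have h := F.equiv.toHomeomorph.measurableEmbedding.integral_map
    (μ := (hypMeasure d).prod volume) g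
  erw [F.map_equiv_eq_smul, integral_smul_nnreal_measure] at h
  exact h.symm

lemma radonH_nor (f : Euc (d + 1) → ℂ) (p : ℝ) :
    RadonH f (p, F.nor) = ∫ y, f (F.pt y p) ∂(hypMeasure d) := by
  simpa using radonH_eq_integral F f p 1 one_pos

lemma integral_radonH_mul {R : ℝ} {f : Euc (d + 1) → ℂ} (hf : IsTestFun R f) {h : ℝ → ℂ}
    (hh : Continuous h) :
    ∫ p, RadonH f (p, F.nor) * h p = sliceConst d * ∫ x, f x * h (inner ℝ x F.nor) := by
  have hc : Continuous fun x => f x * h (inner ℝ x F.nor) :=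
    hf.1.continuous.mul (hh.comp (by fun_prop))
  have hi : Integrable fun x => f x * h (inner ℝ x F.nor) :=
    hc.integrable_of_hasCompactSupport hf.hasCompactSupport.mul_right
  rw [← F.integral_comp_pt, integral_prod_symm _ (F.integrable_comp_pt hi)]
  refine integral_congr_ae (Filter.Eventually.of_forall fun p => ?_)
  simp only [F.radonH_nor, F.inner_pt_nor]
  exact (integral_mul_const _ _).symm

end HypFrame

lemma integral_radonH_mul {R : ℝ} {f : Euc (d + 1) → ℂ} (hf : IsTestFun R f) {h : ℝ → ℂ}
    (hh : Continuous h) {ω : Euc (d + 1)} (hω : ‖ω‖ = 1) :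
    ∫ p, RadonH f (p, ω) * h p = sliceConst d * ∫ x, f x * h (inner ℝ x ω) := by
  obtain ⟨F, rfl⟩ := HypFrame.exists_nor_eq ω hω
  exact F.integral_radonH_mul hf hh

open FourierTransform in
lemma fourier_radonH {R : ℝ} {f : Euc (d + 1) → ℂ} (hf : IsTestFun R f)
    {ω : Euc (d + 1)} (hω : ‖ω‖ = 1) (s : ℝ) :
    𝓕 (fun p => RadonH f (p, ω)) s = sliceConst d * 𝓕 f (s • ω) := by
  have h := integral_radonH_mul hf (h := fun p => cexp (↑(-2 * π * (p * s)) * I))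
    (by fun_prop) hω
  rw [Real.fourier_eq', Real.fourier_eq']
  simp only [smul_eq_mul]
  simp_rw [mul_comm (cexp _)]
  refine (integral_congr_ae (Filter.Eventually.of_forall fun p => ?_)).trans (h.trans ?_)
  · simp [mul_comm]
  · congr 1
    refine integral_congr_ae (Filter.Eventually.of_forall fun x => ?_)
    simp [inner_smul_right, mul_comm]

lemma isHomog0_radonH (f : Euc n → ℂ) : IsHomog0 (RadonH f) := by
  intro r t x ht
  simp only [RadonH]
  congr 2
  ext y
  have : ∑ i, y i * (t • x) i = t * ∑ i, y i * x i := by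
    rw [Finset.mul_sum]
    exact Finset.sum_congr rfl fun i _ => by simp; ring
  simp only [Set.mem_ofPred_eq, this, norm_smul, Real.norm_eq_abs, abs_of_pos ht]
  rw [show r * (t * ‖x‖) = t * (r * ‖x‖) by ring, mul_right_inj' ht.ne']

lemma radonH_neg (f : Euc n → ℂ) (r : ℝ) (x : Euc n) : RadonH f (-r, -x) = RadonH f (r, x) := by
  simp only [RadonH]
  congr 2
  ext y
  simp

lemma radonH_eq_zero {R : ℝ} {f : Euc (d + 1) → ℂ} (hf : IsTestFun R f) {r : ℝ}
    (hr : R < |r|) (x : Euc (d + 1)) : RadonH f (r, x) = 0 := by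
  by_cases hx : x = 0
  · subst hx
    rw [RadonH]
    have hs : {y : Euc (d + 1) | ∑ i, y i * (0 : Euc (d + 1)) i = r * ‖(0 : Euc (d + 1))‖} =
        Set.univ := by ext; simp
    simp only [hs, Measure.restrict_univ]
    by_cases h0 : f = 0
    · simp [h0]
    obtain ⟨y, hy⟩ := Function.ne_iff.1 h0
    have hy' : 0 < ‖f y‖ := norm_pos_iff.2 hy
    refine integral_undef fun hi => ?_
    have hO : IsOpen {x | ‖f y‖ / 2 < ‖f x‖} :=
      isOpen_lt continuous_const hf.1.continuous.norm
    have h1 : (μH[((d + 1 : ℕ) : ℝ)] : Measure (Euc (d + 1))) {x | ‖f y‖ / 2 < ‖f x‖} ≠ 0 :=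
      (hO.measure_pos _ ⟨y, half_lt_self hy'⟩).ne'
    have h2 := (Measure.hausdorffMeasure_zero_or_top
      (show (((d + 1 : ℕ) : ℝ) - 1) < ((d + 1 : ℕ) : ℝ) by linarith)
      {x | ‖f y‖ / 2 < ‖f x‖}).resolve_left h1
    have h3 := hi.measure_norm_gt_lt_top (half_pos hy')
    exact h3.ne h2
  · obtain ⟨F, hF⟩ := exists_frame_smul x hx
    rw [hF, radonH_eq_integral F f r _ (norm_pos_iff.2 hx)]
    refine integral_eq_zero_of_ae (Filter.Eventually.of_forall fun y => hf.2 _ ?_)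
    exact hr.trans_le (F.abs_le_norm_pt y r)

lemma exists_moment_polynomial {R : ℝ} {f : Euc n → ℂ} (hf : IsTestFun R f) (k : ℕ) :
    ∃ P : MvPolynomial (Fin n) ℂ, P.IsHomogeneous k ∧ ∀ ω : Euc n,
      ∫ x, f x * (inner ℝ x ω : ℂ) ^ k = MvPolynomial.eval (fun i => (ω i : ℂ)) P := by
  refine ⟨∑ j : Fin k → Fin n, MvPolynomial.C (∫ x, f x * ∏ l, (x (j l) : ℂ)) *
    ∏ l, MvPolynomial.X (j l), ?_, fun ω => ?_⟩
  · refine MvPolynomial.IsHomogeneous.sum _ _ _ fun j _ => ?_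
    have h := MvPolynomial.IsHomogeneous.prod (univ : Finset (Fin k))
      (fun l => (MvPolynomial.X (j l) : MvPolynomial (Fin n) ℂ)) (fun _ => 1)
      fun l _ => MvPolynomial.isHomogeneous_X _ _
    simpa using (MvPolynomial.isHomogeneous_C _ _).mul h
  · have h1 : ∀ x : Euc n, f x * (inner ℝ x ω : ℂ) ^ k = ∑ j : Fin k → Fin n,
        (f x * ∏ l, (x (j l) : ℂ)) * ∏ l, (ω (j l) : ℂ) := by
      intro x
      have h2 : (inner ℝ x ω : ℂ) = ∑ i, (x i : ℂ) * (ω i : ℂ) := by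
        rw [PiLp.inner_apply]
        push_cast
        exact Finset.sum_congr rfl fun i _ => by simp [mul_comm]
      rw [h2, Fintype.sum_pow, Finset.mul_sum]
      exact Finset.sum_congr rfl fun j _ => by rw [Finset.prod_mul_distrib, mul_assoc]
    simp_rw [h1]
    rw [integral_finsetSum]
    · simp_rw [integral_mul_const]
      simp
    · intro j _
      refine Integrable.mul_const ?_ _
      refine Continuous.integrable_of_hasCompactSupport ?_ hf.hasCompactSupport.mul_right
      exact hf.1.continuous.mul (by fun_prop)

lemma isDHR_radonH {R : ℝ} {f : Euc (d + 1) → ℂ} (hf : IsTestFun R f) : IsDHR R (RadonH f) := by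
  refine ⟨isHomog0_radonH f, radonH_neg f, contDiffOn_radonH_ne_zero hf,
    fun r x hr => radonH_eq_zero hf hr x, fun k => ?_⟩
  obtain ⟨P, hP, h⟩ := exists_moment_polynomial hf k
  refine ⟨MvPolynomial.C (sliceConst d : ℂ) * P, ?_, fun ω hω => ?_⟩
  · simpa using (MvPolynomial.isHomogeneous_C _ _).mul hP
  · rw [map_mul, MvPolynomial.eval_C, ← h]
    exact integral_radonH_mul hf (h := fun p => (p : ℂ) ^ k) (by fun_prop) hω

end Slicing

section Slices

open scoped FourierTransform

variable {R : ℝ} {φ : ℝ × Euc n → ℂ}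

lemma bSemi_nonneg (R : ℝ) (m : ℕ) (φ : ℝ × Euc n → ℂ) : 0 ≤ bSemi R m φ :=
  Real.iSup_nonneg fun _ => Real.iSup_nonneg fun _ => Real.iSup_nonneg fun _ =>
    Real.iSup_nonneg fun _ => norm_nonneg _

lemma IsDHR.norm_iteratedFDerivWithin_le (hφ : IsDHR R φ) (m : ℕ) {p : ℝ} {ω : Euc n}
    (hp : |p| ≤ R) (hω : ‖ω‖ = 1) :
    ‖iteratedFDerivWithin ℝ m φ (Set.univ ×ˢ {x : Euc n | x ≠ 0}) (p, ω)‖ ≤ bSemi R m φ := by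
  have hO := isOpen_ne_zero (n := n)
  have hK : IsCompact (Set.Icc (-R) R ×ˢ Metric.sphere (0 : Euc n) 1) :=
    isCompact_Icc.prod (isCompact_sphere _ _)
  have hc : ContinuousOn (iteratedFDerivWithin ℝ m φ (Set.univ ×ˢ {x : Euc n | x ≠ 0}))
      (Set.Icc (-R) R ×ˢ Metric.sphere (0 : Euc n) 1) :=
    (hφ.2.2.1.continuousOn_iteratedFDerivWithin (mod_cast le_top) hO.uniqueDiffOn).mono
      fun q hq => ⟨trivial, by
        have : ‖q.2‖ = 1 := by simpa using hq.2
        exact norm_ne_zero_iff.1 (by rw [this]; exact one_ne_zero)⟩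
  obtain ⟨C, hC⟩ := hK.exists_bound_of_continuousOn hc
  have hC' : ∀ (p : ℝ) (ω : Euc n), |p| ≤ R → ‖ω‖ = 1 →
      ‖iteratedFDerivWithin ℝ m φ (Set.univ ×ˢ {x : Euc n | x ≠ 0}) (p, ω)‖ ≤ |C| :=
    fun p ω hp hω => (hC (p, ω) ⟨abs_le.1 hp, by simpa using hω⟩).trans (le_abs_self C)
  have hb (p : ℝ) (hp : |p| ≤ R) (ω : Euc n) : (⨆ (_ : ‖ω‖ = 1),
      ‖iteratedFDerivWithin ℝ m φ (Set.univ ×ˢ {x : Euc n | x ≠ 0}) (p, ω)‖) ≤ |C| :=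
    Real.iSup_le (fun hω => hC' p ω hp hω) (abs_nonneg _)
  refine le_ciSup_of_le ⟨|C|, ?_⟩ p (le_ciSup_of_le (Set.finite_range _).bddAbove hp
    (le_ciSup_of_le ⟨|C|, ?_⟩ ω (le_ciSup_of_le (Set.finite_range _).bddAbove hω le_rfl)))
  · rintro _ ⟨p, rfl⟩
    exact Real.iSup_le (fun hp => Real.iSup_le (hb p hp) (abs_nonneg _)) (abs_nonneg _)
  · rintro _ ⟨ω, rfl⟩
    exact hb p hp ω

lemma IsDHR.contDiff_slice (hφ : IsDHR R φ) {ω : Euc n} (hω : ω ≠ 0) :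
    ContDiff ℝ (⊤ : ℕ∞) fun p => φ (p, ω) :=
  contDiffOn_univ.1 (hφ.2.2.1.comp (s := Set.univ) (g := φ) (f := fun p : ℝ => (p, ω))
    (by fun_prop) fun _ _ => ⟨trivial, hω⟩)

lemma IsDHR.norm_iteratedDeriv_slice_le (hφ : IsDHR R φ) {ω : Euc n} (hω : ‖ω‖ = 1) (m : ℕ)
    {p : ℝ} (hp : |p| ≤ R) : ‖iteratedDeriv m (fun p => φ (p, ω)) p‖ ≤ bSemi R m φ := by
  have hω0 : ω ≠ 0 := norm_ne_zero_iff.1 (by rw [hω]; exact one_ne_zero)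
  let s : Set (ℝ × Euc n) := Set.univ ×ˢ {x : Euc n | x ≠ 0}
  let t : Set (ℝ × Euc n) := (fun z => z + (0, ω)) ⁻¹' s
  have hs : IsOpen s := isOpen_ne_zero
  have ht : IsOpen t := hs.preimage (by fun_prop)
  let ψ : ℝ × Euc n → ℂ := fun z => φ (z + (0, ω))
  have hψ : ContDiffOn ℝ (⊤ : ℕ∞) ψ t :=
    hφ.2.2.1.comp (g := φ) (f := fun z => z + (0, ω)) (by fun_prop) fun _ h => h
  let g := ContinuousLinearMap.inl ℝ ℝ (Euc n)
  have hgt : g ⁻¹' t = Set.univ := by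
    ext q
    simp [g, t, s, hω0]
  have hgp : g p ∈ t := by
    have : p ∈ g ⁻¹' t := by rw [hgt]; trivial
    exact this
  have h1 := g.iteratedFDerivWithin_comp_right hψ ht.uniqueDiffOn
    (by rw [hgt]; exact uniqueDiffOn_univ) hgp (i := m) (mod_cast le_top)
  have h2 : ψ ∘ g = fun p => φ (p, ω) := by
    ext q
    simp [ψ, g]
  rw [hgt, h2, iteratedFDerivWithin_univ, iteratedFDerivWithin_of_isOpen _ ht hgp] at h1
  rw [← norm_iteratedFDeriv_eq_norm_iteratedDeriv, h1]
  refine (ContinuousMultilinearMap.norm_compContinuousLinearMap_le _ _).trans ?_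
  have h3 : iteratedFDeriv ℝ m ψ (g p) = iteratedFDerivWithin ℝ m φ s (p, ω) := by
    have : g p + (0, ω) = (p, ω) := by simp [g]
    rw [iteratedFDeriv_comp_add_right, this,
      iteratedFDerivWithin_of_isOpen _ hs (show (p, ω) ∈ s from ⟨trivial, hω0⟩)]
  rw [h3, Finset.prod_const]
  have h4 : ‖g‖ ≤ 1 := ContinuousLinearMap.norm_inl_le_one _ _ _
  calc _ ≤ bSemi R m φ * 1 := by
        refine mul_le_mul (hφ.norm_iteratedFDerivWithin_le m hp hω)
          (pow_le_one₀ (norm_nonneg _) h4) (by positivity) (bSemi_nonneg _ _ _)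
    _ = _ := mul_one _

lemma IsDHR.iteratedDeriv_slice_eq_zero (hφ : IsDHR R φ) (ω : Euc n) (m : ℕ)
    {p : ℝ} (hp : R < |p|) : iteratedDeriv m (fun p => φ (p, ω)) p = 0 := by
  have h : (fun p => φ (p, ω)) =ᶠ[nhds p] fun _ => (0 : ℂ) := by
    filter_upwards [(isOpen_lt continuous_const continuous_abs).mem_nhds hp] with q hq
    exact hφ.2.2.2.1 q ω hq
  rw [h.iteratedDeriv_eq]
  simp

lemma IsDHR.hasCompactSupport_slice (hφ : IsDHR R φ) (ω : Euc n) :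
    HasCompactSupport fun p => φ (p, ω) :=
  HasCompactSupport.intro (isCompact_closedBall 0 R) fun p hp => hφ.2.2.2.1 p ω (by simpa using hp)

lemma IsDHR.integral_norm_iteratedDeriv_slice_le (hφ : IsDHR R φ) (hR : 0 ≤ R) {ω : Euc n}
    (hω : ‖ω‖ = 1) (m : ℕ) :
    ∫ p, ‖iteratedDeriv m (fun p => φ (p, ω)) p‖ ≤ 2 * R * bSemi R m φ := by
  have h : ∀ p, p ∉ Set.Icc (-R) R → ‖iteratedDeriv m (fun p => φ (p, ω)) p‖ = 0 := fun p hp => by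
    rw [hφ.iteratedDeriv_slice_eq_zero ω m (by by_contra! h; exact hp (abs_le.1 h)), norm_zero]
  rw [← setIntegral_eq_integral_of_forall_compl_eq_zero h]
  refine (le_abs_self _).trans ?_
  have h2 := norm_setIntegral_le_of_norm_le_const (μ := volume) (s := Set.Icc (-R) R)
    (f := fun p => ‖iteratedDeriv m (fun p => φ (p, ω)) p‖) (C := bSemi R m φ)
    (by simp) fun p hp => by
      rw [norm_norm]
      exact hφ.norm_iteratedDeriv_slice_le hω m (abs_le.2 hp)
  refine h2.trans (le_of_eq ?_)
  rw [Real.volume_real_Icc_of_le (by linarith)]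
  ring

lemma IsDHR.fourier_slice_decay (hφ : IsDHR R φ) (hR : 0 ≤ R) {ω : Euc n} (hω : ‖ω‖ = 1) (K : ℕ)
    (s : ℝ) : (1 + |s|) ^ K * ‖𝓕 (fun p => φ (p, ω)) s‖ ≤
      2 ^ K * (2 * R) * (bSemi R 0 φ + bSemi R K φ) := by
  have hω0 : ω ≠ 0 := norm_ne_zero_iff.1 (by rw [hω]; exact one_ne_zero)
  have hc := hφ.contDiff_slice hω0
  have hi (m : ℕ) : Integrable (iteratedDeriv m fun p => φ (p, ω)) := by
    refine (hc.continuous_iteratedDeriv m (mod_cast le_top)).integrable_of_hasCompactSupport ?_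
    exact HasCompactSupport.intro (isCompact_closedBall 0 R) fun p hp =>
      hφ.iteratedDeriv_slice_eq_zero ω m (by simpa using hp)
  have hb (g : ℝ → ℂ) : ‖𝓕 g s‖ ≤ ∫ p, ‖g p‖ :=
    VectorFourier.norm_fourierIntegral_le_integral_norm _ _ _ _ _
  have h0 : ‖𝓕 (fun p => φ (p, ω)) s‖ ≤ 2 * R * bSemi R 0 φ :=
    (hb _).trans (by simpa using hφ.integral_norm_iteratedDeriv_slice_le hR hω 0)
  have h1 : |s| ^ K * ‖𝓕 (fun p => φ (p, ω)) s‖ ≤ 2 * R * bSemi R K φ := by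
    have h2 := congrFun (Real.fourier_iteratedDeriv (N := ⊤) (n := K) hc (fun m _ => hi m) le_top) s
    have h3 := hb (iteratedDeriv K fun p => φ (p, ω))
    rw [h2, norm_smul, norm_pow] at h3
    refine (le_trans ?_ h3).trans (hφ.integral_norm_iteratedDeriv_slice_le hR hω K)
    gcongr
    simp only [norm_mul, Complex.norm_real, Complex.norm_I, Complex.norm_ofNat, Real.norm_eq_abs,
      mul_one, abs_of_pos Real.pi_pos]
    nlinarith [Real.pi_gt_three, abs_nonneg s]
  have h4 : (1 + |s|) ^ K ≤ 2 ^ K * (1 + |s| ^ K) := by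
    rcases le_total |s| 1 with h | h
    · calc (1 + |s|) ^ K ≤ 2 ^ K := by gcongr; linarith
        _ ≤ _ := le_mul_of_one_le_right (by positivity) (by simp)
    · calc (1 + |s|) ^ K ≤ (2 * |s|) ^ K := by gcongr; linarith
        _ ≤ _ := by rw [mul_pow]; gcongr; simp
  calc _ ≤ 2 ^ K * (1 + |s| ^ K) * ‖𝓕 (fun p => φ (p, ω)) s‖ := by gcongr
    _ = 2 ^ K * (‖𝓕 (fun p => φ (p, ω)) s‖ + |s| ^ K * ‖𝓕 (fun p => φ (p, ω)) s‖) := by ring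
    _ ≤ 2 ^ K * (2 * R * bSemi R 0 φ + 2 * R * bSemi R K φ) := by gcongr
    _ = _ := by ring

end Slices

section Inversion

open scoped FourierTransform

variable {d : ℕ} {R : ℝ} {f : Euc (d + 1) → ℂ}

/-- Polar decomposition with a non-degenerate direction at the origin. -/
lemma exists_eq_smul_unit (ξ : Euc (d + 1)) : ∃ ω : Euc (d + 1), ‖ω‖ = 1 ∧ ξ = ‖ξ‖ • ω := by
  by_cases h : ξ = 0
  · exact ⟨EuclideanSpace.single 0 1, by simp, by simp [h]⟩
  · obtain ⟨F, hF⟩ := exists_frame_smul ξ h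
    exact ⟨F.nor, F.norm_nor, hF⟩

lemma fourier_eq_fourier_radonH (hf : IsTestFun R f) {ω : Euc (d + 1)} (hω : ‖ω‖ = 1) (s : ℝ) :
    𝓕 f (s • ω) = (sliceConst d : ℂ)⁻¹ * 𝓕 (fun p => RadonH f (p, ω)) s := by
  rw [fourier_radonH hf hω, inv_mul_cancel_left₀]
  exact_mod_cast (sliceConst_pos d).ne'

lemma eq_of_fourier_eq {g : Euc (d + 1) → ℂ} (hf : IsTestFun R f) (hg : IsTestFun R g)
    (h : 𝓕 f = 𝓕 g) : f = g := by
  have h1 : 𝓕 hf.toSchwartz = 𝓕 hg.toSchwartz := by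
    apply DFunLike.coe_injective
    rw [SchwartzMap.fourier_coe, SchwartzMap.fourier_coe, hf.coe_toSchwartz, hg.coe_toSchwartz, h]
  have h2 : hf.toSchwartz = hg.toSchwartz := by
    have := congrArg (fun g => 𝓕⁻ g) h1
    simpa using this
  rw [← hf.coe_toSchwartz, h2, hg.coe_toSchwartz]

lemma eq_of_radonH_eq {g : Euc (d + 1) → ℂ} (hf : IsTestFun R f) (hg : IsTestFun R g)
    (h : ∀ (p : ℝ) (ω : Euc (d + 1)), ‖ω‖ = 1 → RadonH f (p, ω) = RadonH g (p, ω)) : f = g := by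
  refine eq_of_fourier_eq hf hg (funext fun ξ => ?_)
  obtain ⟨ω, hω, hξ⟩ := exists_eq_smul_unit ξ
  rw [hξ, fourier_eq_fourier_radonH hf hω, fourier_eq_fourier_radonH hg hω]
  simp only [h _ ω hω]

lemma fourier_decay (hf : IsTestFun R f) (hR : 0 ≤ R) (K : ℕ) (ξ : Euc (d + 1)) :
    (1 + ‖ξ‖) ^ K * ‖𝓕 f ξ‖ ≤ (sliceConst d)⁻¹ * (2 ^ K * (2 * R) *
      (bSemi R 0 (RadonH f) + bSemi R K (RadonH f))) := by
  obtain ⟨ω, hω, hξ⟩ := exists_eq_smul_unit ξ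
  have h := (isDHR_radonH hf).fourier_slice_decay hR hω K ‖ξ‖
  have hc := sliceConst_pos d
  conv_lhs => rw [hξ]
  rw [fourier_eq_fourier_radonH hf hω, norm_mul, norm_inv, Complex.norm_real, Real.norm_eq_abs,
    abs_of_pos hc, mul_left_comm, norm_smul, hω, mul_one]
  rw [abs_norm] at h
  rw [norm_norm]
  gcongr

lemma norm_iteratedFDeriv_fourier_le {g : Euc n → ℂ} (m : ℕ)
    (hg : ∀ i : ℕ, Integrable fun ξ => ‖ξ‖ ^ i * ‖g ξ‖) (hg' : AEStronglyMeasurable g)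
    (x : Euc n) :
    ‖iteratedFDeriv ℝ m (𝓕 g) x‖ ≤ (2 * π) ^ m * ∫ ξ, ‖ξ‖ ^ m * ‖g ξ‖ := by
  rw [Real.iteratedFDeriv_fourier (N := ⊤) (fun i _ => hg i) hg' (n := m) le_top]
  refine (VectorFourier.norm_fourierIntegral_le_integral_norm _ _ _ _ _).trans ?_
  rw [← integral_const_mul]
  refine integral_mono_of_nonneg (Filter.Eventually.of_forall fun _ => norm_nonneg _)
    ((hg m).const_mul _) (Filter.Eventually.of_forall fun ξ => ?_)
  refine (VectorFourier.norm_fourierPowSMulRight_le (innerSL ℝ) g ξ m).trans ?_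
  have : ‖innerSL ℝ (E := Euc n)‖ ≤ 1 := norm_innerSL_le ℝ
  have h2 : 2 * π * ‖innerSL ℝ (E := Euc n)‖ ≤ 2 * π := mul_le_of_le_one_right (by positivity) this
  simp only [← mul_assoc]
  exact mul_le_mul_of_nonneg_right (mul_le_mul_of_nonneg_right (pow_le_pow_left₀ (by positivity)
    h2 m) (by positivity)) (norm_nonneg _)

lemma exists_dSemi_le (d : ℕ) {R : ℝ} (hR : 0 ≤ R) (m : ℕ) : ∃ C > (0 : ℝ), ∃ M : ℕ,
    ∀ f : Euc (d + 1) → ℂ, IsTestFun R f →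
      dSemi m f ≤ C * ∑ m' ∈ Finset.range (M + 1), bSemi R m' (RadonH f) := by
  let K := m + (d + 2)
  let A : ℝ := ∫ ξ : Euc (d + 1), (1 + ‖ξ‖) ^ (-((d + 2 : ℕ) : ℝ))
  have hA : Integrable fun ξ : Euc (d + 1) => (1 + ‖ξ‖) ^ (-((d + 2 : ℕ) : ℝ)) :=
    integrable_one_add_norm (by simp)
  let B : ℝ := (2 * π) ^ m * A * ((sliceConst d)⁻¹ * (2 ^ K * (2 * R) * 2))
  refine ⟨|B| + 1, by positivity, K, fun f hf => ?_⟩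
  let S := ∑ m' ∈ Finset.range (K + 1), bSemi R m' (RadonH f)
  have hS0 : 0 ≤ S := Finset.sum_nonneg fun _ _ => bSemi_nonneg _ _ _
  have hS (i : ℕ) (hi : i ≤ K) : bSemi R i (RadonH f) ≤ S :=
    Finset.single_le_sum (f := fun m' => bSemi R m' (RadonH f)) (fun _ _ => bSemi_nonneg _ _ _)
      (Finset.mem_range.2 (by omega))
  have hc := sliceConst_pos d
  have hdecay (ξ : Euc (d + 1)) : ‖ξ‖ ^ m * ‖𝓕 f ξ‖ ≤ (1 + ‖ξ‖) ^ (-((d + 2 : ℕ) : ℝ)) *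
      ((sliceConst d)⁻¹ * (2 ^ K * (2 * R) * (2 * S))) := by
    have h1 := fourier_decay hf hR K ξ
    rw [Real.rpow_neg (by positivity), Real.rpow_natCast, le_inv_mul_iff₀ (by positivity)]
    calc (1 + ‖ξ‖) ^ (d + 2) * (‖ξ‖ ^ m * ‖𝓕 f ξ‖)
        ≤ (1 + ‖ξ‖) ^ (d + 2) * ((1 + ‖ξ‖) ^ m * ‖𝓕 f ξ‖) := by gcongr; linarith
      _ = (1 + ‖ξ‖) ^ K * ‖𝓕 f ξ‖ := by simp only [K, pow_add]; ring
      _ ≤ _ := h1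
      _ ≤ _ := by gcongr; linarith [hS 0 (Nat.zero_le _), hS K le_rfl]
  have hF : 𝓕⁻ (𝓕 f) = f := by
    rw [← hf.coe_toSchwartz, ← SchwartzMap.fourier_coe, ← SchwartzMap.fourierInv_coe]
    simp
  have hfi (i : ℕ) : Integrable fun ξ => ‖ξ‖ ^ i * ‖𝓕 f ξ‖ := by
    rw [← hf.coe_toSchwartz, ← SchwartzMap.fourier_coe]
    exact (𝓕 hf.toSchwartz).integrable_pow_mul volume i
  have hF' : f = 𝓕 fun ξ => 𝓕 f (-ξ) := by
    rw [← Real.fourierInv_eq_fourier_comp_neg, hF]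
  have hfi' (i : ℕ) : Integrable fun ξ => ‖ξ‖ ^ i * ‖𝓕 f (-ξ)‖ := by
    simpa only [norm_neg] using (hfi i).comp_neg
  have hmeas : AEStronglyMeasurable fun ξ => 𝓕 f (-ξ) := by
    have : Continuous (𝓕 f) := by
      rw [← hf.coe_toSchwartz, ← SchwartzMap.fourier_coe]
      exact SchwartzMap.continuous _
    exact (this.comp continuous_neg).aestronglyMeasurable
  have hI : ∫ ξ, ‖ξ‖ ^ m * ‖𝓕 f (-ξ)‖ ≤ A * ((sliceConst d)⁻¹ * (2 ^ K * (2 * R) * (2 * S))) := by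
    rw [← integral_mul_const]
    refine integral_mono (hfi' m) (hA.mul_const _) fun ξ => ?_
    simpa only [norm_neg] using hdecay (-ξ)
  refine Real.iSup_le (fun x => ?_) (by positivity)
  rw [hF']
  refine (norm_iteratedFDeriv_fourier_le m hfi' hmeas x).trans ?_
  rw [← hF']
  calc (2 * π) ^ m * ∫ ξ, ‖ξ‖ ^ m * ‖𝓕 f (-ξ)‖
      ≤ (2 * π) ^ m * (A * ((sliceConst d)⁻¹ * (2 ^ K * (2 * R) * (2 * S)))) := by gcongr
    _ = B * S := by simp only [B]; ring
    _ ≤ (|B| + 1) * S := by gcongr; linarith [le_abs_self B]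

end Inversion

section UpperHalfPlane

open Filter Topology

/-- The Phragmén–Lindelöf principle in the upper half-plane for functions of exponential type. -/
lemma norm_le_of_upper_half_plane {f : ℂ → ℂ} {B C D D' : ℝ}
    (hd : ∀ z : ℂ, 0 ≤ z.im → DifferentiableAt ℂ f z)
    (hexp : ∀ z : ℂ, 0 ≤ z.im → ‖f z‖ ≤ D * Real.exp (B * ‖z‖))
    (him : ∀ y : ℝ, 0 ≤ y → ‖f (y * I)‖ ≤ D') (hre : ∀ x : ℝ, ‖f x‖ ≤ C) {z : ℂ}
    (hz : 0 ≤ z.im) : ‖f z‖ ≤ C := by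
  have hI (w : ℂ) : (I * w).im = w.re := by simp
  have h := PhragmenLindelof.right_half_plane_of_bounded_on_real (f := fun w => f (I * w))
    (C := C) (z := -I * z) ?_ ⟨1, by norm_num, B, ?_⟩ ?_ ?_ (by simpa using hz)
  · simpa [← mul_assoc] using h
  · refine DifferentiableOn.diffContOnCl fun w hw => ?_
    have hw' : 0 ≤ w.re := by
      rw [Complex.closure_setOfPred_lt_re] at hw
      exact hw
    exact ((hd (I * w) (by rw [hI]; exact hw')).comp w (by fun_prop)).differentiableWithinAt
  · refine Asymptotics.IsBigO.of_bound D ?_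
    refine eventually_inf_principal.2 (Eventually.of_forall fun w hw => ?_)
    have := hexp (I * w) (by rw [hI]; exact le_of_lt hw)
    simpa [Real.abs_exp] using this
  · refine isBoundedUnder_of_eventually_le (a := D') ?_
    filter_upwards [eventually_ge_atTop 0] with x hx
    simpa [mul_comm] using him x hx
  · intro x
    have : I * (x * I) = ((-x : ℝ) : ℂ) := by
      push_cast
      linear_combination (x : ℂ) * I_mul_I
    simpa only [this] using hre (-x)

lemma le_norm_add_I_mul {z : ℂ} {a : ℝ} (ha : 0 ≤ a) (hz : 0 ≤ z.im) :
    ‖z‖ ≤ ‖z + a * I‖ ∧ a ≤ ‖z + a * I‖ := by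
  constructor
  · rw [← sq_le_sq₀ (norm_nonneg _) (norm_nonneg _), Complex.sq_norm, Complex.sq_norm,
      normSq_apply, normSq_apply]
    simp
    nlinarith [mul_nonneg ha hz]
  · refine le_trans ?_ (Complex.abs_im_le_norm _)
    rw [abs_of_nonneg (by simp; positivity)]
    simpa using hz

lemma integral_eq_zero_of_upper_half_plane {f : ℂ → ℂ} {C : ℝ} (hd : Differentiable ℂ f)
    (hf : ∀ z : ℂ, 0 ≤ z.im → ‖f z‖ * ‖z + I‖ ^ 2 ≤ C) : ∫ x : ℝ, f x = 0 := by
  have hf' (z : ℂ) (hz : 0 ≤ z.im) (T : ℝ) (hT : 0 < T) (hTz : T ≤ ‖z‖) : ‖f z‖ ≤ C / T ^ 2 := by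
    rw [le_div_iff₀ (by positivity)]
    refine le_trans ?_ (hf z hz)
    have := (le_norm_add_I_mul zero_le_one hz).1
    simp only [Complex.ofReal_one, one_mul] at this
    gcongr
    exact hTz.trans this
  have hfi : Integrable fun x : ℝ => f x := by
    refine (integrable_inv_one_add_sq.const_mul C).mono'
      (hd.continuous.comp Complex.continuous_ofReal).aestronglyMeasurable
      (Eventually.of_forall fun x => ?_)
    have h := hf x (by simp)
    have h1 : ‖(x : ℂ) + I‖ ^ 2 = 1 + x ^ 2 := by
      rw [Complex.sq_norm, normSq_apply]
      simp
      ring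
    rw [h1] at h
    rw [← div_eq_mul_inv, le_div_iff₀ (by positivity)]
    exact h
  have hlim : Tendsto (fun T : ℝ => ∫ x in (-T)..T, f x) atTop (𝓝 (∫ x : ℝ, f x)) :=
    intervalIntegral_tendsto_integral hfi tendsto_neg_atTop_atBot tendsto_id
  refine tendsto_nhds_unique hlim ?_
  have hbound : ∀ T : ℝ, 0 < T → ‖∫ x in (-T)..T, f x‖ ≤ 4 * C * T⁻¹ := by
    intro T hT
    have h := Complex.integral_boundary_rect_eq_zero_of_differentiableOn f ((-T : ℝ) : ℂ)
      ((T : ℂ) + T * I) hd.differentiableOn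
    simp only [ofReal_re, ofReal_im, add_re, add_im, mul_re, mul_im, I_re, I_im, mul_zero, mul_one,
      zero_mul, add_zero, zero_add, sub_self, ofReal_zero] at h
    have h1 : ‖∫ x in (-T)..T, f (x + T * I)‖ ≤ C / T ^ 2 * |T - -T| := by
      refine intervalIntegral.norm_integral_le_of_norm_le_const fun x _ => ?_
      refine hf' _ (by simp [hT.le]) T hT ?_
      refine le_trans ?_ (Complex.abs_im_le_norm _)
      simp [abs_of_pos hT]
    have h2 (s : ℝ) (hs : |s| = T) : ‖∫ y in (0 : ℝ)..T, f (s + y * I)‖ ≤ C / T ^ 2 * |T - 0| := by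
      refine intervalIntegral.norm_integral_le_of_norm_le_const fun y hy => ?_
      rw [Set.uIoc_of_le hT.le] at hy
      refine hf' _ (by simp [hy.1.le]) T hT ?_
      refine le_trans ?_ (Complex.abs_re_le_norm _)
      simp [hs]
    have h3 := h2 T (abs_of_pos hT)
    have h4 := h2 (-T) (by rw [abs_neg, abs_of_pos hT])
    have h5 : ∫ x in (-T)..T, f x = (∫ x in (-T)..T, f (x + T * I)) -
        I • (∫ y in (0 : ℝ)..T, f (T + y * I)) +
        I • ∫ y in (0 : ℝ)..T, f ((-T : ℝ) + y * I) := by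
      linear_combination h
    rw [h5]
    refine (norm_add_le _ _).trans ((add_le_add_left (norm_sub_le _ _) _).trans ?_)
    simp only [norm_smul, norm_I, one_mul]
    refine (add_le_add (add_le_add h1 h3) h4).trans (le_of_eq ?_)
    rw [sub_zero, abs_of_pos hT, sub_neg_eq_add, abs_of_pos (by linarith)]
    field_simp
    ring
  refine squeeze_zero_norm' ((eventually_gt_atTop 0).mono hbound) ?_
  simpa using tendsto_inv_atTop_zero.const_mul (4 * C)

end UpperHalfPlane

section HomogeneousPolynomials

open MvPolynomial

variable {P : MvPolynomial (Fin n) ℂ} {k : ℕ}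

lemma sum_eq_of_isHomogeneous (hP : P.IsHomogeneous k) {m : Fin n →₀ ℕ} (hm : m ∈ P.support) :
    ∑ i, m i = k := by
  have h := hP (MvPolynomial.mem_support_iff.1 hm)
  rw [← h, Finsupp.weight_apply, Finsupp.sum_fintype _ _ (by simp)]
  simp

lemma eval_smul_of_isHomogeneous (hP : P.IsHomogeneous k) (t : ℂ) (z : Fin n → ℂ) :
    eval (t • z) P = t ^ k * eval z P := by
  rw [eval_eq', eval_eq', Finset.mul_sum]
  refine Finset.sum_congr rfl fun m hm => ?_
  simp only [Pi.smul_apply, smul_eq_mul, mul_pow, Finset.prod_mul_distrib]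
  rw [Finset.prod_pow_eq_pow_sum, sum_eq_of_isHomogeneous hP hm]
  ring

lemma exists_norm_eval_le (hP : P.IsHomogeneous k) : ∃ D : ℝ, ∀ (z : Fin n → ℂ) (B : ℝ),
    (∀ i, ‖z i‖ ≤ B) → ‖eval z P‖ ≤ D * B ^ k := by
  refine ⟨∑ m ∈ P.support, ‖P.coeff m‖, fun z B hz => ?_⟩
  rw [eval_eq', Finset.sum_mul]
  refine (norm_sum_le _ _).trans (Finset.sum_le_sum fun m hm => ?_)
  rw [norm_mul, ← sum_eq_of_isHomogeneous hP hm, ← Finset.prod_pow_eq_pow_sum]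
  gcongr
  rw [norm_prod]
  refine Finset.prod_le_prod (fun _ _ => norm_nonneg _) fun i _ => ?_
  rw [norm_pow]
  exact pow_le_pow_left₀ (norm_nonneg _) (hz i) _

/-- The complex line through `w` in the direction `ω`. -/
def complexLine (w ω : Euc n) (s : ℂ) : Fin n → ℂ := fun i => w i + s * ω i

lemma complexLine_ofReal (w ω : Euc n) (s : ℝ) :
    complexLine w ω s = fun i => (((w + s • ω) i : ℝ) : ℂ) := by
  ext i
  simp [complexLine]

lemma differentiable_eval_complexLine (P : MvPolynomial (Fin n) ℂ) (w ω : Euc n) :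
    Differentiable ℂ fun s => eval (complexLine w ω s) P := by
  simp only [eval_eq', complexLine]
  fun_prop

lemma norm_eval_complexLine_le_of_im_nonneg (hP : P.IsHomogeneous k) {M R : ℝ}
    (hM : ∀ v : Euc n, ‖eval (fun i => (v i : ℂ)) P‖ ≤ M * (R * ‖v‖) ^ k)
    (hMR : 0 ≤ M * R ^ k) {w ω : Euc n} (hω : ‖ω‖ = 1) (hw : inner ℝ w ω = 0) {s : ℂ}
    (hs : 0 ≤ s.im) :
    ‖eval (complexLine w ω s) P‖ ≤ M * (R * (‖s‖ + (‖w‖ + 1))) ^ k := by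
  let a : ℝ := ‖w‖ + 1
  have ha : 1 ≤ a := by simp [a]
  have ha0 : 0 ≤ a := zero_le_one.trans ha
  have hpos (z : ℂ) (hz : 0 ≤ z.im) : 0 < ‖z + a * I‖ :=
    (zero_lt_one.trans_le ha).trans_le (le_norm_add_I_mul ha0 hz).2
  have hne (z : ℂ) (hz : 0 ≤ z.im) : z + a * I ≠ 0 := norm_pos_iff.1 (hpos z hz)
  obtain ⟨D, hD⟩ := exists_norm_eval_le hP
  have hcoord (v : Euc n) (i : Fin n) : ‖(v i : ℂ)‖ ≤ ‖v‖ := by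
    rw [Complex.norm_real]
    exact PiLp.norm_apply_le v i
  have hbd (z : ℂ) (hz : 0 ≤ z.im) :
      ‖eval (complexLine w ω z) P / (z + a * I) ^ k‖ ≤ |D| * 2 ^ k := by
    rw [norm_div, norm_pow, div_le_iff₀ (pow_pos (hpos z hz) k), mul_assoc, ← mul_pow]
    refine (hD _ (2 * ‖z + a * I‖) fun i => ?_).trans
      (mul_le_mul_of_nonneg_right (le_abs_self D) (by positivity))
    obtain ⟨h1, h2⟩ := le_norm_add_I_mul ha0 hz
    refine (norm_add_le _ _).trans ?_
    rw [norm_mul]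
    have h3 := hcoord w i
    have h4 : ‖z‖ * ‖(ω i : ℂ)‖ ≤ ‖z‖ := mul_le_of_le_one_right (norm_nonneg _) (hω ▸ hcoord ω i)
    simp only [a] at h2 ⊢
    linarith
  have hreal (x : ℝ) : ‖eval (complexLine w ω x) P / ((x : ℂ) + a * I) ^ k‖ ≤ M * R ^ k := by
    rw [norm_div, norm_pow, div_le_iff₀ (pow_pos (hpos x (by simp)) k), complexLine_ofReal]
    refine (hM _).trans ?_
    rw [mul_pow, ← mul_assoc]
    gcongr
    refine le_of_sq_le_sq ?_ (norm_nonneg _)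
    rw [norm_add_sq_real, inner_smul_right, hw, norm_smul, hω, Complex.sq_norm, normSq_apply]
    simp only [a, add_re, add_im, ofReal_re, ofReal_im, mul_re, mul_im, I_re, I_im]
    have := norm_nonneg w
    simp only [mul_one, Real.norm_eq_abs, sq_abs]
    nlinarith
  have key := norm_le_of_upper_half_plane (B := 0) (C := M * R ^ k) (D := |D| * 2 ^ k)
    (D' := |D| * 2 ^ k) (f := fun z => eval (complexLine w ω z) P / (z + a * I) ^ k)
    (fun z hz => ((differentiable_eval_complexLine P w ω) z).div (by fun_prop)
      (pow_ne_zero k (hne z hz)))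
    (fun z hz => by simpa using hbd z hz) (fun y hy => hbd _ (by simpa using hy)) hreal hs
  rw [norm_div, norm_pow, div_le_iff₀ (pow_pos (hpos s hs) k)] at key
  refine key.trans ?_
  rw [mul_pow, ← mul_assoc]
  gcongr
  refine (norm_add_le _ _).trans ?_
  rw [norm_mul, norm_I, mul_one, Complex.norm_real, Real.norm_eq_abs, abs_of_nonneg ha0]

lemma norm_eval_complexLine_le (hP : P.IsHomogeneous k) {M R : ℝ}
    (hM : ∀ v : Euc n, ‖eval (fun i => (v i : ℂ)) P‖ ≤ M * (R * ‖v‖) ^ k)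
    (hMR : 0 ≤ M * R ^ k) {w ω : Euc n} (hω : ‖ω‖ = 1) (hw : inner ℝ w ω = 0) (s : ℂ) :
    ‖eval (complexLine w ω s) P‖ ≤ M * (R * (‖s‖ + (‖w‖ + 1))) ^ k := by
  rcases le_total 0 s.im with hs | hs
  · exact norm_eval_complexLine_le_of_im_nonneg hP hM hMR hω hw hs
  · have h := norm_eval_complexLine_le_of_im_nonneg hP hM hMR (w := w) (ω := -ω) (s := -s)
      (by rwa [norm_neg]) (by rw [inner_neg_right, hw, neg_zero]) (by simpa using hs)
    have h1 : complexLine w (-ω) (-s) = complexLine w ω s := by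
      ext i
      simp [complexLine]
    rwa [h1, norm_neg] at h

end HomogeneousPolynomials

section MomentSeries

open Filter Topology MvPolynomial

/-- The Fourier transform reconstructed from the moment polynomials. -/
def momentSeries (P : ℕ → MvPolynomial (Fin n) ℂ) (z : Fin n → ℂ) : ℂ :=
  ∑' k, (-2 * π * I) ^ k / k.factorial * eval z (P k)

/-- The moment series at a real vector. -/
def realMomentSeries (P : ℕ → MvPolynomial (Fin n) ℂ) (v : Euc n) : ℂ :=
  momentSeries P fun i => v i

variable {P : ℕ → MvPolynomial (Fin n) ℂ} {M R : ℝ}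

lemma norm_momentSeries_term_le {z : Fin n → ℂ} {B : ℝ} {k : ℕ}
    (h : ‖eval z (P k)‖ ≤ M * (R * B) ^ k) :
    ‖(-2 * π * I) ^ k / k.factorial * eval z (P k)‖ ≤
      M * ((2 * π * R * B) ^ k / k.factorial) := by
  have h1 : ‖(-2 * π * I : ℂ)‖ = 2 * π := by
    simp [abs_of_pos Real.pi_pos]
  rw [norm_mul, norm_div, norm_pow, h1, Complex.norm_natCast]
  calc _ ≤ (2 * π) ^ k / k.factorial * (M * (R * B) ^ k) := by gcongr
    _ = _ := by rw [mul_assoc (2 * π), mul_pow (2 * π)]; ring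

lemma summable_momentSeries_bound (M B : ℝ) :
    Summable fun k : ℕ => M * (B ^ k / k.factorial) :=
  (Real.summable_pow_div_factorial B).mul_left M

lemma continuous_realMomentSeries (hR : 0 ≤ R) (hM0 : 0 ≤ M)
    (hM : ∀ k (v : Euc n), ‖eval (fun i => (v i : ℂ)) (P k)‖ ≤ M * (R * ‖v‖) ^ k) :
    Continuous (realMomentSeries P) := by
  refine continuous_iff_continuousAt.2 fun v₀ => ?_
  have h : ContinuousOn (realMomentSeries P) (Metric.ball 0 (‖v₀‖ + 1)) := by
    refine continuousOn_tsum (fun k => ?_)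
      (summable_momentSeries_bound M (2 * π * R * (‖v₀‖ + 1))) fun k v hv => ?_
    · simp only [eval_eq']
      fun_prop
    · refine norm_momentSeries_term_le ((hM k v).trans ?_)
      have : ‖v‖ ≤ ‖v₀‖ + 1 := by simpa using (mem_ball_zero_iff.1 hv).le
      gcongr
  exact h.continuousAt (Metric.isOpen_ball.mem_nhds (by simp))

section Line

variable (hP : ∀ k, (P k).IsHomogeneous k) (hR : 0 ≤ R) (hM0 : 0 ≤ M)
  (hM : ∀ k (v : Euc n), ‖eval (fun i => (v i : ℂ)) (P k)‖ ≤ M * (R * ‖v‖) ^ k)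
  {w ω : Euc n} (hω : ‖ω‖ = 1) (hw : inner ℝ w ω = 0)

include hP hR hM0 hM hω hw

lemma norm_momentSeries_line_term_le (k : ℕ) {s : ℂ} {B : ℝ} (hs : ‖s‖ ≤ B) :
    ‖(-2 * π * I) ^ k / k.factorial * eval (complexLine w ω s) (P k)‖ ≤
      M * ((2 * π * R * (B + (‖w‖ + 1))) ^ k / k.factorial) := by
  refine norm_momentSeries_term_le
    ((norm_eval_complexLine_le (hP k) (hM k) (by positivity) hω hw s).trans ?_)
  gcongr

lemma differentiable_momentSeries_line :
    Differentiable ℂ fun s => momentSeries P (complexLine w ω s) := by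
  intro s
  have h : DifferentiableOn ℂ (fun s => momentSeries P (complexLine w ω s))
      (Metric.ball 0 (‖s‖ + 1)) :=
    differentiableOn_tsum_of_summable_norm
      (summable_momentSeries_bound M (2 * π * R * ((‖s‖ + 1) + (‖w‖ + 1))))
      (fun k => ((differentiable_eval_complexLine (P k) w ω).const_mul _).differentiableOn)
      Metric.isOpen_ball fun k z hz => norm_momentSeries_line_term_le hP hR hM0 hM hω hw k
        (mem_ball_zero_iff.1 hz).le
  exact h.differentiableAt (Metric.isOpen_ball.mem_nhds (by simp))

lemma norm_momentSeries_line_le (s : ℂ) :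
    ‖momentSeries P (complexLine w ω s)‖ ≤
      M * Real.exp (2 * π * R * (‖s‖ + (‖w‖ + 1))) := by
  have h1 := summable_momentSeries_bound M (2 * π * R * (‖s‖ + (‖w‖ + 1)))
  refine (tsum_of_norm_bounded h1.hasSum fun k =>
    norm_momentSeries_line_term_le hP hR hM0 hM hω hw k le_rfl).trans (le_of_eq ?_)
  rw [tsum_mul_left, Real.exp_eq_exp_ℝ, NormedSpace.exp_eq_tsum_div]

/-- The Paley–Wiener argument: the inverse Fourier transform of the moment series along a line
vanishes beyond the radius of support. -/
lemma integral_momentSeries_line_eq_zero {C : ℝ}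
    (hC : ∀ v : Euc n, (1 + ‖v‖) ^ 2 * ‖realMomentSeries P v‖ ≤ C) {r : ℝ} (hr : R < r) :
    ∫ s : ℝ, cexp (2 * π * r * s * I) * realMomentSeries P (w + s • ω) = 0 := by
  let G : ℂ → ℂ := fun s => momentSeries P (complexLine w ω s)
  let g : ℂ → ℂ := fun s => cexp (2 * π * r * s * I) * G s
  have hGd : Differentiable ℂ G := differentiable_momentSeries_line hP hR hM0 hM hω hw
  have hgd : Differentiable ℂ g := by
    have : Differentiable ℂ fun s : ℂ => cexp (2 * π * r * s * I) := by fun_prop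
    exact this.mul hGd
  have hG (s : ℂ) : ‖G s‖ ≤ M * Real.exp (2 * π * R * (‖s‖ + (‖w‖ + 1))) :=
    norm_momentSeries_line_le hP hR hM0 hM hω hw s
  have hexp (s : ℂ) : ‖cexp (2 * π * r * s * I)‖ = Real.exp (-(2 * π * r * s.im)) := by
    rw [Complex.norm_exp]
    congr 1
    have : (2 * π * r * s * I : ℂ) = ((2 * π * r : ℝ) : ℂ) * (s * I) := by push_cast; ring
    rw [this, Complex.re_ofReal_mul]
    simp
  have hreal (x : ℝ) : G x = realMomentSeries P (w + x • ω) := by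
    simp only [G, realMomentSeries, complexLine_ofReal]
  suffices h : ∫ s : ℝ, g s = 0 by
    rw [← h]
    exact integral_congr_ae (Eventually.of_forall fun s => by simp only [g, hreal])
  refine integral_eq_zero_of_upper_half_plane (C := C) hgd fun z hz => ?_
  have hr0 : 0 ≤ r := hR.trans hr.le
  have hsq (z : ℂ) : ‖z + I‖ ^ 2 ≤ 2 * Real.exp ‖z‖ ^ 2 := by
    have h1 : ‖z + I‖ ≤ Real.exp ‖z‖ :=
      ((norm_add_le _ _).trans_eq (by rw [norm_I])).trans (Real.add_one_le_exp _)
    nlinarith [norm_nonneg (z + I), Real.exp_pos ‖z‖]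
  have key := norm_le_of_upper_half_plane (f := fun z => g z * (z + I) ^ 2) (C := C)
    (B := 2 * π * R + 2) (D := M * Real.exp (2 * π * R * (‖w‖ + 1)) * 2) (z := z)
    (D' := M * Real.exp (2 * π * R * (‖w‖ + 1)) * (2 / (2 * π * (r - R)) ^ 2 *
      (2 * Real.exp (2 * π * (r - R)))))
    (fun z _ => (hgd z).mul (by fun_prop)) ?_ ?_ ?_ hz
  · simpa [norm_mul, norm_pow] using key
  · intro z hz
    rw [norm_mul, norm_mul, norm_pow, hexp]
    have h1 : Real.exp (-(2 * π * r * z.im)) ≤ 1 :=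
      Real.exp_le_one_iff.2 (by simpa using by positivity)
    calc _ ≤ 1 * (M * Real.exp (2 * π * R * (‖z‖ + (‖w‖ + 1)))) * (2 * Real.exp ‖z‖ ^ 2) := by
          gcongr
          · exact hG z
          · exact hsq z
      _ = _ := by
          rw [mul_add (2 * π * R), add_mul (2 * π * R), Real.exp_add, Real.exp_add,
            two_mul ‖z‖, Real.exp_add ‖z‖]
          ring
  · intro y hy
    rw [norm_mul, norm_mul, norm_pow, hexp]
    have h1 : ((y : ℂ) * I).im = y := by simp
    have h2 : ‖(y : ℂ) * I‖ = y := by simp [abs_of_nonneg hy]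
    have h3 : ‖(y : ℂ) * I + I‖ = y + 1 := by
      rw [show (y : ℂ) * I + I = ((y + 1 : ℝ) : ℂ) * I by push_cast; ring, norm_mul, norm_I,
        mul_one, Complex.norm_real, Real.norm_eq_abs, abs_of_nonneg (by positivity)]
    have h4 := hG ((y : ℂ) * I)
    rw [h2] at h4
    rw [h1, h3]
    have hb : 0 < 2 * π * (r - R) := mul_pos (by positivity) (by linarith)
    have h5 : (2 * π * (r - R)) ^ 2 * (y + 1) ^ 2 ≤
        2 * Real.exp (2 * π * (r - R) * (y + 1)) := by
      have := Real.quadratic_le_exp_of_nonneg (x := 2 * π * (r - R) * (y + 1)) (by positivity)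
      have h0 : 0 ≤ 2 * π * (r - R) * (y + 1) := by positivity
      nlinarith
    have h6 : (y + 1) ^ 2 ≤ 2 / (2 * π * (r - R)) ^ 2 * Real.exp (2 * π * (r - R) * (y + 1)) := by
      rw [div_mul_eq_mul_div, le_div_iff₀ (by positivity)]
      linarith
    calc _ ≤ Real.exp (-(2 * π * r * y)) * (M * Real.exp (2 * π * R * (y + (‖w‖ + 1)))) *
          (2 / (2 * π * (r - R)) ^ 2 * Real.exp (2 * π * (r - R) * (y + 1))) := by gcongr
      _ = M * (2 / (2 * π * (r - R)) ^ 2) * (Real.exp (-(2 * π * r * y)) *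
          Real.exp (2 * π * R * (y + (‖w‖ + 1))) * Real.exp (2 * π * (r - R) * (y + 1))) := by ring
      _ = M * (2 / (2 * π * (r - R)) ^ 2) * (Real.exp (2 * π * R * (‖w‖ + 1)) *
          Real.exp (2 * π * (r - R))) := by
          rw [← Real.exp_add, ← Real.exp_add, ← Real.exp_add]
          ring_nf
      _ ≤ _ := by
          have : 0 ≤ M * (2 / (2 * π * (r - R)) ^ 2) * (Real.exp (2 * π * R * (‖w‖ + 1)) *
            Real.exp (2 * π * (r - R))) := by positivity
          linarith
  · intro x
    rw [norm_mul, norm_mul, norm_pow, hexp, hreal]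
    simp only [ofReal_im, mul_zero, neg_zero, Real.exp_zero, one_mul]
    refine le_trans ?_ (hC (w + x • ω))
    rw [mul_comm]
    gcongr
    have h1 : ‖(x : ℂ) + I‖ ≤ |x| + 1 := (norm_add_le _ _).trans (by simp)
    have h2 : |x| ≤ ‖w + x • ω‖ := by
      have h3 := abs_real_inner_le_norm (w + x • ω) ω
      rwa [inner_add_left, hw, inner_smul_left, real_inner_self_eq_norm_sq, hω, zero_add,
        one_pow, mul_one, mul_one] at h3
    linarith

end Line

end MomentSeries

section Surjectivity

open Filter Topology
open scoped FourierTransform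

variable {d : ℕ} {R : ℝ} {φ : ℝ × Euc (d + 1) → ℂ}

/-- The polynomials `P k` are the moments of `φ`. -/
def IsMoments (φ : ℝ × Euc n → ℂ) (P : ℕ → MvPolynomial (Fin n) ℂ) : Prop :=
  ∀ k, (P k).IsHomogeneous k ∧ ∀ ω : Euc n, ‖ω‖ = 1 →
    (∫ r : ℝ, φ (r, ω) * (r : ℂ) ^ k) = MvPolynomial.eval (fun i => (ω i : ℂ)) (P k)

lemma IsDHR.exists_isMoments {φ : ℝ × Euc n → ℂ} (hφ : IsDHR R φ) : ∃ P, IsMoments φ P := by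
  choose P hP using hφ.2.2.2.2
  exact ⟨P, hP⟩

variable {P : ℕ → MvPolynomial (Fin (d + 1)) ℂ}

lemma IsMoments.eval_smul (hP : IsMoments φ P) (k : ℕ) (t : ℝ) (v : Euc (d + 1)) :
    MvPolynomial.eval (fun i => (((t • v) i : ℝ) : ℂ)) (P k) =
      (t : ℂ) ^ k * MvPolynomial.eval (fun i => (v i : ℂ)) (P k) := by
  rw [← eval_smul_of_isHomogeneous (hP k).1]
  congr 1
  simp only [PiLp.smul_apply, smul_eq_mul, ofReal_mul]
  rfl

lemma IsMoments.norm_eval_le (hP : IsMoments φ P) (hφ : IsDHR R φ) (hR : 0 ≤ R) (k : ℕ)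
    (v : Euc (d + 1)) :
    ‖MvPolynomial.eval (fun i => (v i : ℂ)) (P k)‖ ≤ 2 * R * bSemi R 0 φ * (R * ‖v‖) ^ k := by
  obtain ⟨ω, hω, hv⟩ := exists_eq_smul_unit v
  have hω0 : ω ≠ 0 := norm_ne_zero_iff.1 (by rw [hω]; exact one_ne_zero)
  have h1 : ‖MvPolynomial.eval (fun i => (ω i : ℂ)) (P k)‖ ≤ 2 * R * bSemi R 0 φ * R ^ k := by
    rw [← (hP k).2 ω hω]
    refine (norm_integral_le_integral_norm _).trans ?_
    have h2 := hφ.integral_norm_iteratedDeriv_slice_le hR hω 0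
    simp only [iteratedDeriv_zero] at h2
    have hi : Integrable fun p => ‖φ (p, ω)‖ :=
      ((hφ.contDiff_slice hω0).continuous.integrable_of_hasCompactSupport
        (hφ.hasCompactSupport_slice ω)).norm
    refine le_trans ?_ (mul_le_mul_of_nonneg_right h2 (by positivity))
    rw [← integral_mul_const]
    refine integral_mono_of_nonneg (Eventually.of_forall fun _ => norm_nonneg _)
      (hi.mul_const _) (Eventually.of_forall fun p => ?_)
    simp only [norm_mul, norm_pow, Complex.norm_real, Real.norm_eq_abs]
    rcases le_or_gt |p| R with hp | hp
    · gcongr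
    · simp [hφ.2.2.2.1 p ω hp]
  conv_lhs => rw [hv]
  rw [hP.eval_smul, norm_mul, norm_pow, Complex.norm_real, norm_norm, mul_pow, mul_comm (R ^ k),
    ← mul_assoc, mul_right_comm, mul_comm]
  gcongr

lemma IsMoments.realMomentSeries_smul (hP : IsMoments φ P) (hφ : IsDHR R φ) {ω : Euc (d + 1)}
    (hω : ‖ω‖ = 1) (s : ℝ) : realMomentSeries P (s • ω) = 𝓕 (fun p => φ (p, ω)) s := by
  have hω0 : ω ≠ 0 := norm_ne_zero_iff.1 (by rw [hω]; exact one_ne_zero)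
  have hc := (hφ.contDiff_slice hω0).continuous
  have hi := hc.integrable_of_hasCompactSupport (hφ.hasCompactSupport_slice ω) (μ := volume)
  have hexp (x : ℝ) : HasSum (fun k : ℕ => x ^ k / k.factorial) (Real.exp x) := by
    rw [Real.exp_eq_exp_ℝ]
    exact NormedSpace.expSeries_div_hasSum_exp x
  have hcexp (x : ℂ) : HasSum (fun k : ℕ => x ^ k / k.factorial) (cexp x) := by
    rw [Complex.exp_eq_exp_ℂ]
    exact NormedSpace.expSeries_div_hasSum_exp x
  have hbs (p : ℝ) := (hexp (2 * π * |s| * R)).mul_left ‖φ (p, ω)‖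
  have h := hasSum_integral_of_dominated_convergence (μ := volume)
    (F := fun (k : ℕ) (p : ℝ) => φ (p, ω) * ((-2 * π * I * (p * s)) ^ k / k.factorial))
    (f := fun p => φ (p, ω) * cexp (-2 * π * I * (p * s)))
    (fun k p => ‖φ (p, ω)‖ * ((2 * π * |s| * R) ^ k / k.factorial))
    (fun k => (hc.mul (by fun_prop)).aestronglyMeasurable)
    (fun k => Eventually.of_forall fun p => ?_)
    (Eventually.of_forall fun p => (hbs p).summable)
    ?_ (Eventually.of_forall fun p => (hcexp _).mul_left _)
  · rw [Real.fourier_eq', realMomentSeries, momentSeries]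
    refine Eq.trans ?_ (h.tsum_eq.trans ?_)
    · congr 1
      ext k
      rw [hP.eval_smul, ← (hP k).2 ω hω, ← mul_assoc, ← integral_const_mul]
      refine integral_congr_ae (Eventually.of_forall fun p => ?_)
      simp only [mul_pow]
      ring
    · refine integral_congr_ae (Eventually.of_forall fun p => ?_)
      simp only [smul_eq_mul]
      rw [mul_comm]
      congr 2
      simp
      ring
  · rw [norm_mul, norm_div, norm_pow, Complex.norm_natCast]
    rcases le_or_gt |p| R with hp | hp
    · gcongr
      simp only [norm_mul, norm_neg, Complex.norm_ofNat, Complex.norm_real, Real.norm_eq_abs,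
        abs_of_pos Real.pi_pos, norm_I, mul_one]
      rw [mul_comm |p|, ← mul_assoc]
      gcongr
    · simp [hφ.2.2.2.1 p ω hp]
  · simp only [fun p => (hbs p).tsum_eq]
    exact hi.norm.mul_const _

section

variable (hP : IsMoments φ P) (hφ : IsDHR R φ) (hR : 0 ≤ R)

include hP hφ hR

lemma IsMoments.continuous_realMomentSeries : Continuous (realMomentSeries P) :=
  _root_.continuous_realMomentSeries hR (mul_nonneg (by positivity) (bSemi_nonneg R 0 φ))
    (hP.norm_eval_le hφ hR)

lemma IsMoments.realMomentSeries_decay (K : ℕ) : ∃ C : ℝ, ∀ v : Euc (d + 1),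
    (1 + ‖v‖) ^ K * ‖realMomentSeries P v‖ ≤ C := by
  refine ⟨2 ^ K * (2 * R) * (bSemi R 0 φ + bSemi R K φ), fun v => ?_⟩
  obtain ⟨ω, hω, hv⟩ := exists_eq_smul_unit v
  have h := hφ.fourier_slice_decay hR hω K ‖v‖
  rwa [abs_norm, ← hP.realMomentSeries_smul hφ hω, ← hv] at h

lemma IsMoments.integrable_realMomentSeries (m : ℕ) :
    Integrable fun v : Euc (d + 1) => ‖v‖ ^ m * ‖realMomentSeries P v‖ := by
  obtain ⟨C, hC⟩ := hP.realMomentSeries_decay hφ hR (m + (d + 2))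
  have hA : Integrable fun v : Euc (d + 1) => (1 + ‖v‖) ^ (-((d + 2 : ℕ) : ℝ)) :=
    integrable_one_add_norm (by simp)
  have hc := hP.continuous_realMomentSeries hφ hR
  refine (hA.mul_const C).mono' (by fun_prop) (Eventually.of_forall fun v => ?_)
  rw [Real.norm_of_nonneg (by positivity), Real.rpow_neg (by positivity), Real.rpow_natCast,
    le_inv_mul_iff₀ (by positivity)]
  calc (1 + ‖v‖) ^ (d + 2) * (‖v‖ ^ m * ‖realMomentSeries P v‖)
      ≤ (1 + ‖v‖) ^ (d + 2) * ((1 + ‖v‖) ^ m * ‖realMomentSeries P v‖) := by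
        gcongr
        linarith
    _ = (1 + ‖v‖) ^ (m + (d + 2)) * ‖realMomentSeries P v‖ := by
        rw [pow_add _ m]
        ring
    _ ≤ C := hC v

lemma IsMoments.integrable_realMomentSeries' : Integrable (realMomentSeries P) := by
  refine (integrable_norm_iff
    (hP.continuous_realMomentSeries hφ hR).aestronglyMeasurable).1 ?_
  simpa using hP.integrable_realMomentSeries hφ hR 0

lemma IsMoments.fourierInv_eq_zero {x : Euc (d + 1)} (hx : R < ‖x‖) :
    𝓕⁻ (realMomentSeries P) x = 0 := by
  have hx0 : x ≠ 0 := norm_pos_iff.1 (hR.trans_lt hx)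
  obtain ⟨F, hF⟩ := exists_frame_smul x hx0
  obtain ⟨C, hC⟩ := hP.realMomentSeries_decay hφ hR 2
  have hi : Integrable fun v : Euc (d + 1) =>
      cexp (2 * π * ‖x‖ * (inner ℝ v F.nor : ℝ) * I) * realMomentSeries P v := by
    refine (hP.integrable_realMomentSeries' hφ hR).bdd_mul (c := 1)
      (by fun_prop) (Eventually.of_forall fun v => le_of_eq ?_)
    rw [← Complex.norm_exp_ofReal_mul_I (2 * π * ‖x‖ * inner ℝ v F.nor)]
    push_cast
    rfl
  have h1 : ∫ v : Euc (d + 1),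
      cexp (2 * π * ‖x‖ * (inner ℝ v F.nor : ℝ) * I) * realMomentSeries P v = 0 := by
    have h2 := F.integral_comp_pt fun v =>
      cexp (2 * π * ‖x‖ * (inner ℝ v F.nor : ℝ) * I) * realMomentSeries P v
    rw [integral_prod _ (F.integrable_comp_pt hi)] at h2
    have h3 : ∀ y : Euc d, ∫ s : ℝ, cexp (2 * π * ‖x‖ * (inner ℝ (F.pt y s) F.nor : ℝ) * I) *
        realMomentSeries P (F.pt y s) = 0 := by
      intro y
      simp only [F.inner_pt_nor]
      exact integral_momentSeries_line_eq_zero (fun k => (hP k).1) hR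
        (mul_nonneg (by positivity) (bSemi_nonneg R 0 φ)) (hP.norm_eval_le hφ hR) F.norm_nor
        (F.inner_emb_nor y) hC hx
    simp only [h3, integral_zero] at h2
    exact (mul_eq_zero.1 h2.symm).resolve_left (by exact_mod_cast (sliceConst_pos d).ne')
  rw [Real.fourierInv_eq', ← h1]
  refine integral_congr_ae (Eventually.of_forall fun v => ?_)
  simp only [smul_eq_mul]
  congr 3
  conv_lhs => rw [hF, inner_smul_right]
  push_cast
  ring

lemma IsMoments.isTestFun_fourierInv : IsTestFun R (𝓕⁻ (realMomentSeries P)) := by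
  refine ⟨?_, fun x hx => hP.fourierInv_eq_zero hφ hR hx⟩
  rw [Real.fourierInv_eq_fourier_comp_neg]
  refine Real.contDiff_fourier (N := (⊤ : ℕ∞)) fun m _ => ?_
  simpa only [norm_neg] using (hP.integrable_realMomentSeries hφ hR m).comp_neg

lemma IsMoments.fourier_fourierInv : 𝓕 (𝓕⁻ (realMomentSeries P)) = realMomentSeries P := by
  have h := hP.isTestFun_fourierInv hφ hR
  refine (hP.continuous_realMomentSeries hφ hR).fourier_fourierInv_eq
    (hP.integrable_realMomentSeries' hφ hR) ?_
  have h1 : Integrable (𝓕⁻ (realMomentSeries P)) :=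
    h.1.continuous.integrable_of_hasCompactSupport h.hasCompactSupport
  have h2 : 𝓕 (realMomentSeries P) = fun v => 𝓕⁻ (realMomentSeries P) (-v) := by
    ext v
    rw [Real.fourierInv_eq_fourier_neg, neg_neg]
  rw [h2]
  exact h1.comp_neg

end

lemma eq_of_fourier_eq_real {f g : ℝ → ℂ} (hf : ContDiff ℝ (⊤ : ℕ∞) f)
    (hf' : HasCompactSupport f) (hg : ContDiff ℝ (⊤ : ℕ∞) g) (hg' : HasCompactSupport g)
    (h : 𝓕 f = 𝓕 g) : f = g := by
  have h1 : 𝓕 (hf'.toSchwartzMap hf) = 𝓕 (hg'.toSchwartzMap hg) := by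
    apply DFunLike.coe_injective
    rw [SchwartzMap.fourier_coe, SchwartzMap.fourier_coe]
    exact h
  have h2 : hf'.toSchwartzMap hf = hg'.toSchwartzMap hg := by
    have := congrArg (fun g => 𝓕⁻ g) h1
    simpa using this
  exact congrArg (fun g : SchwartzMap ℝ ℂ => (g : ℝ → ℂ)) h2

lemma IsDHR.exists_radonH_eq (hφ : IsDHR R φ) (hR : 0 ≤ R) :
    ∃ f : Euc (d + 1) → ℂ, IsTestFun R f ∧
      ∀ (p : ℝ) (ω : Euc (d + 1)), ‖ω‖ = 1 → RadonH f (p, ω) = φ (p, ω) := by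
  obtain ⟨P, hP⟩ := hφ.exists_isMoments
  have hc : (sliceConst d : ℂ) ≠ 0 := by exact_mod_cast (sliceConst_pos d).ne'
  have h1 := hP.isTestFun_fourierInv hφ hR
  let f : Euc (d + 1) → ℂ := fun x => (sliceConst d : ℂ)⁻¹ • 𝓕⁻ (realMomentSeries P) x
  have hf : IsTestFun R f :=
    ⟨h1.1.const_smul _, fun x hx => by simp [f, h1.2 x hx]⟩
  have hFf (ξ : Euc (d + 1)) : 𝓕 f ξ = (sliceConst d : ℂ)⁻¹ * realMomentSeries P ξ := by
    have h2 := congrFun (hP.fourier_fourierInv hφ hR) ξ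
    rw [← h2, Real.fourier_eq', Real.fourier_eq', ← integral_const_mul]
    refine integral_congr_ae (Eventually.of_forall fun v => ?_)
    simp only [f, smul_eq_mul]
    ring
  refine ⟨f, hf, fun p ω hω => ?_⟩
  have hω0 : ω ≠ 0 := norm_ne_zero_iff.1 (by rw [hω]; exact one_ne_zero)
  have hψ := isDHR_radonH hf
  refine congrFun (eq_of_fourier_eq_real (hψ.contDiff_slice hω0) (hψ.hasCompactSupport_slice ω)
    (hφ.contDiff_slice hω0) (hφ.hasCompactSupport_slice ω) (funext fun s => ?_)) p
  rw [fourier_radonH hf hω, hFf, mul_inv_cancel_left₀ hc, hP.realMomentSeries_smul hφ hω]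

end Surjectivity

/-- **Support theorem for the Radon transform.**  For every `R > 0` the Radon transform
is a linear topological isomorphism of `𝒟_R(ℝⁿ)` onto `𝒟_{H,R}(Ξ)`: it maps `𝒟_R(ℝⁿ)`
bijectively onto `𝒟_{H,R}(Ξ)` and it and its inverse are continuous for the defining
seminorms. -/
theorem stmt2 (n : ℕ) (hn : 2 ≤ n) (R : ℝ) (hR : 0 < R) :
    (∀ f : EuclideanSpace ℝ (Fin n) → ℂ, IsTestFun R f → IsDHR R (RadonH f)) ∧
    (∀ f g : EuclideanSpace ℝ (Fin n) → ℂ, IsTestFun R f → IsTestFun R g →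
      (∀ (p : ℝ) (ω : EuclideanSpace ℝ (Fin n)), ‖ω‖ = 1 →
        RadonH f (p, ω) = RadonH g (p, ω)) → f = g) ∧
    (∀ φ : ℝ × EuclideanSpace ℝ (Fin n) → ℂ, IsDHR R φ →
      ∃ f : EuclideanSpace ℝ (Fin n) → ℂ, IsTestFun R f ∧
        ∀ (p : ℝ) (ω : EuclideanSpace ℝ (Fin n)), ‖ω‖ = 1 →
          RadonH f (p, ω) = φ (p, ω)) ∧
    (∀ m : ℕ, ∃ C > (0 : ℝ), ∃ M : ℕ,
      ∀ f : EuclideanSpace ℝ (Fin n) → ℂ, IsTestFun R f →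
        bSemi R m (RadonH f) ≤ C * ∑ m' ∈ Finset.range (M + 1), dSemi m' f) ∧
    (∀ m : ℕ, ∃ C > (0 : ℝ), ∃ M : ℕ,
      ∀ f : EuclideanSpace ℝ (Fin n) → ℂ, IsTestFun R f →
        dSemi m f ≤ C * ∑ m' ∈ Finset.range (M + 1), bSemi R m' (RadonH f)) := by
  obtain ⟨d, rfl⟩ : ∃ d, n = d + 1 := ⟨n - 1, by lia⟩
  exact ⟨fun f hf => isDHR_radonH hf, fun f g hf hg h => eq_of_radonH_eq hf hg h,
    fun φ hφ => hφ.exists_radonH_eq hR.le, exists_bSemi_radonH_le d R, exists_dSemi_le d hR.le⟩
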